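/- arXiv:1809.00779 — 2 statements merged into one kernel-verified Lean document; each statement's English description precedes it below -/
import Mathlib

section
/- For every real η with 0 < η < 10⁻⁵ and every integer t ≥ exp(η⁻⁵⁰) the following holds. If H is a graph on T vertices with T ≥ 4(1+η)t and with at least (1−η³)·C(T,2) edges, then for every function c from the edge set of H to {1,2,3} there exist a color i ∈ {1,2,3} and an odd cycle in H of length at least (1+η/10)t all of whose edges receive color i under c. -/
open Finset

open scoped Classical in
/-- The number of ordered pairs in `X × Y` that are adjacent in `G`, as a real number. -/
noncomputable def adjPairs {V : Type*} (G : SimpleGraph V) (X Y : Finset V) : ℝ :=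
  ∑ x ∈ X, ∑ y ∈ Y, if G.Adj x y then 1 else 0

section adjPairs

variable {V : Type*} (G : SimpleGraph V)

lemma adjPairs_nonneg (X Y : Finset V) : 0 ≤ adjPairs G X Y := by
  unfold adjPairs
  exact sum_nonneg fun _ _ => sum_nonneg fun _ _ => by split_ifs <;> norm_num

lemma adjPairs_comm (X Y : Finset V) : adjPairs G X Y = adjPairs G Y X := by
  unfold adjPairs
  rw [sum_comm]
  exact sum_congr rfl fun _ _ => sum_congr rfl fun _ _ => by rw [G.adj_comm]

lemma adjPairs_le_mul (X Y : Finset V) : adjPairs G X Y ≤ #X * #Y := by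
  classical
  unfold adjPairs
  calc _ ≤ ∑ x ∈ X, ∑ y ∈ Y, (1 : ℝ) :=
        sum_le_sum fun _ _ => sum_le_sum fun _ _ => by split_ifs <;> norm_num
    _ = _ := by simp

lemma adjPairs_mono {X X' Y Y' : Finset V} (hX : X ⊆ X') (hY : Y ⊆ Y') :
    adjPairs G X Y ≤ adjPairs G X' Y' := by
  unfold adjPairs
  refine (sum_le_sum fun _ _ => sum_le_sum_of_subset_of_nonneg hY fun _ _ _ => ?_).trans
    (sum_le_sum_of_subset_of_nonneg hX fun _ _ _ => sum_nonneg fun _ _ => ?_)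
  all_goals split_ifs <;> norm_num

lemma adjPairs_eq_zero {X Y : Finset V} (h : ∀ x ∈ X, ∀ y ∈ Y, ¬ G.Adj x y) :
    adjPairs G X Y = 0 := by
  unfold adjPairs
  exact sum_eq_zero fun x hx => sum_eq_zero fun y hy => by simp [h x hx y hy]

lemma adjPairs_singleton [DecidableRel G.Adj] (v : V) (Y : Finset V) :
    adjPairs G {v} Y = #{y ∈ Y | G.Adj v y} := by
  unfold adjPairs
  rw [sum_singleton, ← sum_boole]
  exact sum_congr rfl fun _ _ => by congr

variable [DecidableEq V]

lemma adjPairs_union_left {X X' : Finset V} (h : Disjoint X X') (Y : Finset V) :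
    adjPairs G (X ∪ X') Y = adjPairs G X Y + adjPairs G X' Y := by
  unfold adjPairs
  rw [sum_union h]

lemma adjPairs_union_right {Y Y' : Finset V} (h : Disjoint Y Y') (X : Finset V) :
    adjPairs G X (Y ∪ Y') = adjPairs G X Y + adjPairs G X Y' := by
  rw [adjPairs_comm, adjPairs_union_left G h, adjPairs_comm, adjPairs_comm G Y']

lemma adjPairs_union_self {X Y : Finset V} (h : Disjoint X Y) :
    adjPairs G (X ∪ Y) (X ∪ Y) = adjPairs G X X + 2 * adjPairs G X Y + adjPairs G Y Y := by
  rw [adjPairs_union_left G h, adjPairs_union_right G h, adjPairs_union_right G h,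
    adjPairs_comm G Y X]
  ring

end adjPairs

/-- If the ends of a path satisfy the crossing condition, its vertices span a cycle, so a
neighbour outside of it gives a longer path. -/
lemma exists_chain_cons_of_crossing {V : Type*} (G : SimpleGraph V) {a b : List V} {x w : V}
    (hnd : (a ++ b).Nodup) (hch : (a ++ b).IsChain G.Adj)
    (h1 : ∀ y ∈ a.head?, ∀ z ∈ b.head?, G.Adj y z)
    (h2 : ∀ y ∈ b.getLast?, ∀ z ∈ a.getLast?, G.Adj y z)
    (ha : a ≠ []) (hb : b ≠ []) (hx : x ∈ a ++ b) (hw : w ∉ a ++ b) (hadj : G.Adj x w) :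
    ∃ l : List V, l.Nodup ∧ l.IsChain G.Adj ∧ (∀ v ∈ l, v = w ∨ v ∈ a ++ b) ∧
      l.length = (a ++ b).length + 1 := by
  rw [List.isChain_append] at hch
  have hperm : (a ++ b.reverse).Perm (a ++ b) := (List.reverse_perm _).append_left _
  have hcch : (a ++ b.reverse).IsChain G.Adj := by
    rw [List.isChain_append, List.isChain_reverse]
    refine ⟨hch.1, hch.2.1.imp fun _ _ hab => hab.symm, fun y hy z hz => ?_⟩
    rw [List.head?_reverse] at hz
    exact (h2 z hz y hy).symm
  obtain ⟨s, t, hst⟩ := List.append_of_mem (hperm.mem_iff.mpr hx)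
  have hp2 : (x :: t ++ s).Perm (a ++ b) := by
    refine List.Perm.trans ?_ hperm
    rw [hst]
    exact List.perm_append_comm
  refine ⟨w :: (x :: t ++ s), ?_, ?_, fun v hv => ?_, by rw [List.length_cons, hp2.length_eq]⟩
  · rw [List.nodup_cons, hp2.mem_iff, hp2.nodup_iff]
    exact ⟨hw, hnd⟩
  · have hcch' := hcch
    rw [hst, List.isChain_append] at hcch'
    rw [List.isChain_cons, List.isChain_append]
    refine ⟨by simp [hadj.symm], hcch'.2.1, hcch'.1, fun y hy z hz => ?_⟩
    have e1 : y ∈ (a ++ b.reverse).getLast? := by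
      rw [hst, List.getLast?_append]
      simp_all
    have e2 : z ∈ (a ++ b.reverse).head? := by
      rw [hst, List.head?_append]
      simp_all
    rw [List.getLast?_append, List.getLast?_reverse] at e1
    rw [List.head?_append] at e2
    obtain ⟨b0, b', rfl⟩ := List.exists_cons_of_ne_nil hb
    obtain ⟨a0, a', rfl⟩ := List.exists_cons_of_ne_nil ha
    simp only [List.head?_cons, Option.some_or, Option.mem_def, Option.some.injEq] at e1 e2
    subst e1 e2
    exact (h1 _ (by simp) _ (by simp)).symm
  · rw [List.mem_cons, hp2.mem_iff] at hv
    exact hv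

/-- The Erdős–Gallai bound for paths, with paths given as lists of vertices. -/
theorem adjPairs_le_of_forall_path_length_le {V : Type*} (G : SimpleGraph V) (k : ℕ)
    (U : Finset V)
    (h : ∀ l : List V, l.Nodup → l.IsChain G.Adj → (∀ v ∈ l, v ∈ U) → l.length ≤ k) :
    adjPairs G U U ≤ k * #U := by
  classical
  induction U using Finset.strongInduction with
  | H U ih =>
  rcases U.eq_empty_or_nonempty with rfl | ⟨u, hu⟩
  · simp [adjPairs]
  -- it suffices to remove a nonempty set meeting few adjacent pairs
  have key : ∀ S : Finset V, S ⊆ U → S.Nonempty →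
      adjPairs G S S + 2 * adjPairs G S (U \ S) ≤ k * #S → adjPairs G U U ≤ k * #U := by
    intro S hS hne hle
    have h1 := ih (U \ S) (sdiff_ssubset hS hne)
      fun l h1 h2 h3 => h l h1 h2 fun v hv => sdiff_subset (h3 v hv)
    have h2 := adjPairs_union_self G (disjoint_sdiff (s := S) (t := U))
    rw [union_sdiff_of_subset hS] at h2
    have h3 : (#(U \ S) : ℝ) = #U - #S := by
      rw [card_sdiff_of_subset hS, Nat.cast_sub (card_le_card hS)]
    rw [h3] at h1
    linarith
  -- a longest path
  obtain ⟨l, ⟨hnd, hch, hlU, hlen⟩, hmax⟩ : ∃ l : List V,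
      (l.Nodup ∧ l.IsChain G.Adj ∧ (∀ v ∈ l, v ∈ U) ∧ 0 < l.length) ∧
      ∀ l' : List V, l'.Nodup → l'.IsChain G.Adj → (∀ v ∈ l', v ∈ U) →
        l'.length ≤ l.length := by
    let P : ℕ → Prop := fun j => ∃ l : List V,
      (l.Nodup ∧ l.IsChain G.Adj ∧ (∀ v ∈ l, v ∈ U) ∧ l.length = j)
    have hP1 : P 1 := ⟨[u], by simp [hu]⟩
    have hk1 : 1 ≤ k := h [u] (by simp) (by simp) (by simp [hu])
    obtain ⟨l, a1, a2, a3, a4⟩ := Nat.findGreatest_spec (P := P) hk1 hP1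
    have hg := Nat.le_findGreatest (P := P) hk1 hP1
    refine ⟨l, ⟨a1, a2, a3, by omega⟩, fun l' b1 b2 b3 => ?_⟩
    rw [a4]
    exact Nat.le_findGreatest (h l' b1 b2 b3) ⟨l', b1, b2, b3, rfl⟩
  have hlk := h l hnd hch hlU
  obtain ⟨r, hr⟩ : ∃ r, l.length = r + 1 := ⟨l.length - 1, by omega⟩
  have hdeg : ∀ v : V, adjPairs G {v} {v} = 0 := fun v => adjPairs_eq_zero G (by simp)
  -- all neighbours of the two ends lie on the path
  have hend : ∀ w ∈ U, ∀ x ∈ l.head?, G.Adj w x → w ∈ l := by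
    intro w hw x hx hadj
    by_contra hwl
    have := hmax (w :: l) (by simp [hwl, hnd])
      (by rw [List.isChain_cons]; exact ⟨fun y hy => by simp_all, hch⟩)
      (by simpa [hw] using hlU)
    simp at this
  have hend' : ∀ w ∈ U, ∀ x ∈ l.getLast?, G.Adj w x → w ∈ l := by
    intro w hw x hx hadj
    by_contra hwl
    have := hmax (l ++ [w]) (by rw [List.nodup_append]; simp [hnd]; rintro a ha rfl; exact hwl ha)
      (by rw [List.isChain_append]
          refine ⟨hch, by simp, fun y hy z hz => ?_⟩
          simp_all [G.adj_comm])
      (by intro v hv; simp only [List.mem_append, List.mem_singleton] at hv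
          rcases hv with hv | rfl
          · exact hlU v hv
          · exact hw)
    simp at this
  by_cases hcross : ∃ i, ∃ hi : i < r, G.Adj l[0] l[i + 1] ∧ G.Adj l[r] l[i]
  · -- the vertices of the path span a cycle, and no edge leaves them
    obtain ⟨i, hi, hc1, hc2⟩ := hcross
    have hclosed : ∀ x ∈ l, ∀ w ∈ U, G.Adj x w → w ∈ l := by
      intro x hx w hw hadj
      by_contra hwl
      have hl : l = l.take (i + 1) ++ l.drop (i + 1) := (List.take_append_drop _ _).symm
      obtain ⟨l', h1, h2, h3, h4⟩ := exists_chain_cons_of_crossing G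
        (a := l.take (i + 1)) (b := l.drop (i + 1)) (x := x) (w := w)
        (by rwa [← hl]) (by rwa [← hl])
        (by
          intro y hy z hz
          simp [List.head?_eq_getElem?, hlen,
            List.getElem?_eq_getElem (show i + 1 < l.length by omega)] at hy hz
          rwa [← hy, ← hz])
        (by
          intro y hy z hz
          simp only [List.getLast?_eq_getElem?, List.length_drop, hr, List.getElem?_drop,
            List.length_take, show i + 1 + (r + 1 - (i + 1) - 1) = r by omega,
            show min (i + 1) (r + 1) - 1 = i by omega,
            List.getElem?_take_of_lt (Nat.lt_succ_self i),
            List.getElem?_eq_getElem (show i < l.length by omega),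
            List.getElem?_eq_getElem (show r < l.length by omega),
            Option.mem_def, Option.some.injEq] at hy hz
          rwa [← hy, ← hz])
        (by rintro h0; simp at h0; simp [h0] at hlen)
        (by intro h0; simp at h0; omega) (by rwa [← hl]) (by rwa [← hl]) hadj
      rw [← hl] at h3 h4
      have := hmax l' h1 h2 fun v hv => (h3 v hv).elim (fun h => h ▸ hw) (hlU v)
      omega
    refine key l.toFinset (fun v hv => hlU v (by simpa using hv)) ⟨l[0], by simp⟩ ?_
    have h0 : adjPairs G l.toFinset (U \ l.toFinset) = 0 := adjPairs_eq_zero G (by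
      intro x hx y hy hadj
      simp only [mem_sdiff, List.mem_toFinset] at hx hy
      exact hy.2 (hclosed x hx y hy.1 hadj))
    have h1 := adjPairs_le_mul G l.toFinset l.toFinset
    have h2 : (#l.toFinset : ℝ) ≤ k := by
      exact_mod_cast (List.toFinset_card_le l).trans hlk
    rw [h0]
    nlinarith [Nat.cast_nonneg (α := ℝ) #l.toFinset]
  · -- one of the two ends has small degree
    push Not at hcross
    let p : ℕ → V := fun i => l.getD i u
    have hpi : ∀ i (hi : i < l.length), p i = l[i] := fun i hi => by simp [p, hi]
    let I := {i ∈ range r | G.Adj (p 0) (p (i + 1))}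
    let J := {i ∈ range r | G.Adj (p r) (p i)}
    have hIJ : #I + #J ≤ r := by
      have hd : Disjoint I J := by
        rw [Finset.disjoint_left]
        intro i hi hj
        simp only [I, J, mem_filter, mem_range] at hi hj
        have := hcross i hi.1
        rw [hpi _ (by omega), hpi _ (by omega)] at hi hj
        exact this hi.2 hj.2
      rw [← card_union_of_disjoint hd]
      calc _ ≤ #(range r) := card_le_card (union_subset (filter_subset _ _) (filter_subset _ _))
        _ = r := card_range r
    have hI : #{v ∈ U | G.Adj (p 0) v} ≤ #I := by
      refine (card_le_card ?_).trans (card_image_le (s := I) (f := fun i => p (i + 1)))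
      intro v hv
      rw [mem_filter, hpi 0 (by omega)] at hv
      have hvl := hend v hv.1 l[0] (by simp [List.head?_eq_getElem?, hlen]) hv.2.symm
      obtain ⟨j, hj, rfl⟩ := List.getElem_of_mem hvl
      rcases j with _ | j
      · exact absurd hv.2 (by simp)
      · refine mem_image.mpr ⟨j, ?_, hpi _ hj⟩
        simp only [I, mem_filter, mem_range]
        rw [hpi _ hj, hpi 0 (by omega)]
        exact ⟨by omega, hv.2⟩
    have hJ : #{v ∈ U | G.Adj (p r) v} ≤ #J := by
      refine (card_le_card ?_).trans (card_image_le (s := J) (f := p))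
      intro v hv
      rw [mem_filter, hpi r (by omega)] at hv
      have hvl := hend' v hv.1 l[r] (by simp [List.getLast?_eq_getElem?, hr]) hv.2.symm
      obtain ⟨j, hj, rfl⟩ := List.getElem_of_mem hvl
      refine mem_image.mpr ⟨j, ?_, hpi _ hj⟩
      simp only [J, mem_filter, mem_range]
      rw [hpi _ hj, hpi r (by omega)]
      refine ⟨?_, hv.2⟩
      rcases Nat.lt_or_ge j r with h' | h'
      · exact h'
      · obtain rfl : j = r := by omega
        exact absurd hv.2 (by simp)
    have hlast : ∀ v ∈ l, 2 * #{w ∈ U | G.Adj v w} ≤ k → adjPairs G U U ≤ k * #U := by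
      intro v hv hd
      refine key {v} (by simpa using hlU v hv) (by simp) ?_
      rw [hdeg]
      have h1 := adjPairs_mono G (Subset.refl {v}) (sdiff_subset (s := U) (t := {v}))
      rw [adjPairs_singleton G v U] at h1
      have h2 : (2 : ℝ) * #{w ∈ U | G.Adj v w} ≤ k := by exact_mod_cast hd
      simp only [card_singleton, Nat.cast_one]
      linarith
    rcases Nat.lt_or_ge (2 * #I) (k + 1) with hlt | hge
    · exact hlast (p 0) (by rw [hpi 0 (by omega)]; simp) (by omega)
    · exact hlast (p r) (by rw [hpi r (by omega)]; simp) (by omega)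

namespace SimpleGraph.Walk

variable {V : Type*} {G : SimpleGraph V}

/-- Bypassing repeated vertices preserves the parity of the length, unless the walk contains an
odd cycle, given here as an edge together with a path of even length. -/
lemma even_bypass_iff_or_exists_even_path [DecidableEq V] {u v : V} (p : G.Walk u v) :
    (Even p.bypass.length ↔ Even p.length) ∨
      ∃ a b : V, ∃ q : G.Walk a b, G.Adj a b ∧ q.IsPath ∧ Even q.length ∧
        q.length ≤ p.length := by
  induction p with
  | nil => exact Or.inl Iff.rfl
  | @cons u u' v h p ih =>
    rcases ih with ih | ⟨a, b, q, h1, h2, h3, h4⟩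
    · by_cases hu : u ∈ p.bypass.support
      · have hlen : (p.bypass.takeUntil u hu).length + (p.bypass.dropUntil u hu).length
            = p.bypass.length := by
          rw [← length_append, take_spec]
        by_cases hev : Even (p.bypass.takeUntil u hu).length
        · right
          refine ⟨u', u, _, h.symm, p.bypass_isPath.takeUntil hu, hev, ?_⟩
          have := p.length_bypass_le_length
          rw [length_cons]
          omega
        · left
          simp only [bypass, hu, dite_true, length_cons]
          grind
      · left
        simp only [bypass, hu, dite_false, length_cons]
        grind
    · exact Or.inr ⟨a, b, q, h1, h2, h3, by rw [length_cons]; omega⟩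

lemma exists_even_path_of_odd {u : V} (p : G.Walk u u) (hp : Odd p.length) :
    ∃ a b : V, ∃ q : G.Walk a b, G.Adj a b ∧ q.IsPath ∧ Even q.length ∧
      q.length ≤ p.length := by
  classical
  rcases p.even_bypass_iff_or_exists_even_path with h | h
  · rw [length_eq_zero_iff.mpr (isPath_iff_nil.mp p.bypass_isPath)] at h
    simp only [Even.zero, true_iff] at h
    exact absurd h (Nat.not_even_iff_odd.mpr hp)
  · exact h

lemma IsPath.append_of_disjoint {u v w : V} {p : G.Walk u v} {q : G.Walk v w} (hp : p.IsPath)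
    (hq : q.IsPath) (h : ∀ x ∈ p.support, x ∈ q.support → x = v) : (p.append q).IsPath := by
  rw [isPath_def, support_append, List.nodup_append]
  have hq' := hq.support_nodup
  rw [← cons_tail_support, List.nodup_cons] at hq'
  refine ⟨hp.support_nodup, hq'.2, ?_⟩
  rintro x hx y hy rfl
  have := h x hx (List.mem_of_mem_tail hy)
  subst this
  exact hq'.1 hy

end SimpleGraph.Walk

section CutDense

variable {V : Type*} [Fintype V] {G : SimpleGraph V} {ε : ℝ}

open scoped Classical in
/-- The vertices reached from `x` by a walk of length at most `r` avoiding `Z`. -/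
noncomputable def avoidBall (G : SimpleGraph V) (Z : Finset V) (x : V) (r : ℕ) : Finset V :=
  {v | ∃ p : G.Walk x v, p.length ≤ r ∧ ∀ w ∈ p.support, w ∉ Z}

lemma mem_avoidBall {Z : Finset V} {x v : V} {r : ℕ} : v ∈ avoidBall G Z x r ↔
    ∃ p : G.Walk x v, p.length ≤ r ∧ ∀ w ∈ p.support, w ∉ Z := by
  simp [avoidBall]

/-- Neighbours of the ball of radius `r` lie in the ball of radius `r + 1` or in `Z`. -/
lemma mem_avoidBall_succ {Z : Finset V} {x v w : V} {r : ℕ} (hv : v ∈ avoidBall G Z x r)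
    (h : G.Adj v w) (hw : w ∉ Z) : w ∈ avoidBall G Z x (r + 1) := by
  rw [mem_avoidBall] at hv ⊢
  obtain ⟨p, h1, h2⟩ := hv
  refine ⟨p.concat h, by rw [SimpleGraph.Walk.length_concat]; omega, fun y hy => ?_⟩
  rw [SimpleGraph.Walk.support_concat, List.mem_append] at hy
  rcases hy with hy | hy
  · exact h2 y hy
  · rw [List.mem_singleton] at hy
    exact hy ▸ hw

lemma avoidBall_mono {Z : Finset V} {x : V} {r s : ℕ} (h : r ≤ s) :
    avoidBall G Z x r ⊆ avoidBall G Z x s := by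
  intro v hv
  rw [mem_avoidBall] at hv ⊢
  obtain ⟨p, h1, h2⟩ := hv
  exact ⟨p, h1.trans h, h2⟩

variable [DecidableEq V]

/-- Every cut of `G` has density at least `ε`. -/
def CutDense (G : SimpleGraph V) (ε : ℝ) : Prop :=
  ∀ X : Finset V, ε * #X * #Xᶜ ≤ adjPairs G X Xᶜ

lemma CutDense.card_avoidBall (hG : CutDense G ε) (hε : 0 < ε) {Z : Finset V} {x : V}
    (hZ : #Z ≤ ε * Fintype.card V / 4) (hx : x ∉ Z) (r : ℕ) :
    (Fintype.card V : ℝ) / 2 < #(avoidBall G Z x r) ∨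
      r * (ε * Fintype.card V / 4) < #(avoidBall G Z x r) := by
  have hpos : ∀ r, 1 ≤ #(avoidBall G Z x r) := fun r =>
    card_pos.mpr ⟨x, mem_avoidBall.mpr ⟨.nil, by simp, by simpa using hx⟩⟩
  induction r with
  | zero =>
    right
    have := hpos 0
    simp only [Nat.cast_zero, zero_mul, Nat.cast_pos]
    omega
  | succ r ih =>
    have hsub := avoidBall_mono (G := G) (Z := Z) (x := x) (Nat.le_succ r)
    have hle : (#(avoidBall G Z x r) : ℝ) ≤ #(avoidBall G Z x (r + 1)) := by
      exact_mod_cast card_le_card hsub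
    rcases ih with ih | ih
    · exact Or.inl (ih.trans_le hle)
    rcases lt_or_ge ((Fintype.card V : ℝ) / 2) #(avoidBall G Z x r) with h | h
    · exact Or.inl (h.trans_le hle)
    right
    set B := avoidBall G Z x r
    set B' := avoidBall G Z x (r + 1)
    have h1 := hG B
    have h2 : adjPairs G B Bᶜ = adjPairs G B (Bᶜ ∩ ((B' \ B) ∪ Z)) := by
      have hd : Disjoint (Bᶜ ∩ ((B' \ B) ∪ Z)) (Bᶜ \ ((B' \ B) ∪ Z)) :=
        disjoint_sdiff_inter _ _ |>.symm
      have hu : Bᶜ = (Bᶜ ∩ ((B' \ B) ∪ Z)) ∪ (Bᶜ \ ((B' \ B) ∪ Z)) := by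
        rw [union_comm, sdiff_union_inter]
      conv_lhs => rw [hu]
      rw [adjPairs_union_right G hd, adjPairs_eq_zero G (Y := Bᶜ \ ((B' \ B) ∪ Z)), add_zero]
      intro v hv w hw hadj
      simp only [mem_sdiff, mem_compl, mem_union, not_or, not_and, not_not] at hw
      exact hw.1 (hw.2.1 (mem_avoidBall_succ hv hadj hw.2.2))
    have h3 := adjPairs_le_mul G B (Bᶜ ∩ ((B' \ B) ∪ Z))
    have h4 : (#(Bᶜ ∩ ((B' \ B) ∪ Z)) : ℝ) ≤ #B' - #B + #Z := by
      have e1 := (card_le_card (inter_subset_right (s₁ := Bᶜ) (s₂ := (B' \ B) ∪ Z))).trans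
        (card_union_le _ _)
      have e2 := card_sdiff_add_card_eq_card hsub
      have e3 : (#(Bᶜ ∩ ((B' \ B) ∪ Z)) : ℝ) ≤ #(B' \ B) + #Z := by exact_mod_cast e1
      have e4 : (#(B' \ B) : ℝ) + #B = #B' := by exact_mod_cast e2
      linarith
    have h5 : (#Bᶜ : ℝ) = Fintype.card V - #B := by
      rw [card_compl, Nat.cast_sub (card_le_univ _)]
    have hB1 : (1 : ℝ) ≤ #B := by exact_mod_cast hpos r
    have h6 : (#B : ℝ) * (ε * #Bᶜ) ≤ #B * (#B' - #B + #Z) := by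
      nlinarith [mul_le_mul_of_nonneg_left h4 (by linarith : (0 : ℝ) ≤ #B)]
    have h7 := le_of_mul_le_mul_left h6 (by linarith)
    rw [h5] at h7
    push_cast
    nlinarith

/-- In a graph with dense cuts, deleting few vertices leaves a graph of bounded diameter. -/
theorem CutDense.exists_path_avoiding (hG : CutDense G ε) (hε : 0 < ε) {Z : Finset V}
    (hZ : #Z ≤ ε * Fintype.card V / 4) {x y : V} (hx : x ∉ Z) (hy : y ∉ Z) {L : ℕ}
    (hL : 2 / ε ≤ L) :
    ∃ p : G.Walk x y, p.IsPath ∧ p.length ≤ 2 * L ∧ ∀ w ∈ p.support, w ∉ Z := by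
  have hV : (0 : ℝ) < Fintype.card V := by exact_mod_cast Fintype.card_pos_iff.mpr ⟨x⟩
  have hbig : ∀ z ∉ Z, (Fintype.card V : ℝ) / 2 < #(avoidBall G Z z L) := by
    intro z hz
    rcases hG.card_avoidBall hε hZ hz L with h | h
    · exact h
    · refine lt_of_le_of_lt ?_ h
      have : 2 ≤ L * ε := by rwa [div_le_iff₀ hε] at hL
      nlinarith
  have hne : (avoidBall G Z x L ∩ avoidBall G Z y L).Nonempty := by
    rw [← card_pos]
    have h1 := card_union_add_card_inter (avoidBall G Z x L) (avoidBall G Z y L)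
    have h2 := card_le_univ (avoidBall G Z x L ∪ avoidBall G Z y L)
    have h3 : (Fintype.card V : ℝ) < #(avoidBall G Z x L) + #(avoidBall G Z y L) := by
      linarith [hbig x hx, hbig y hy]
    have h4 : Fintype.card V < #(avoidBall G Z x L) + #(avoidBall G Z y L) := by
      exact_mod_cast h3
    omega
  obtain ⟨v, hv⟩ := hne
  rw [mem_inter, mem_avoidBall, mem_avoidBall] at hv
  obtain ⟨⟨p, hp1, hp2⟩, q, hq1, hq2⟩ := hv
  refine ⟨(p.append q.reverse).bypass, SimpleGraph.Walk.bypass_isPath _, ?_, fun w hw => ?_⟩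
  · refine (SimpleGraph.Walk.length_bypass_le_length _).trans ?_
    rw [SimpleGraph.Walk.length_append, SimpleGraph.Walk.length_reverse]
    omega
  · have := SimpleGraph.Walk.support_bypass_subset_support _ hw
    rw [SimpleGraph.Walk.mem_support_append_iff, SimpleGraph.Walk.support_reverse,
      List.mem_reverse] at this
    exact this.elim (hp2 w) (hq2 w)

/-- A small set linking every vertex of `D` to `c`, away from `Z`. -/
theorem CutDense.exists_hub (hG : CutDense G ε) (hε : 0 < ε) {Z D : Finset V}
    (hZ : #Z ≤ ε * Fintype.card V / 4) {c : V} (hc : c ∉ Z) (hD : Disjoint D Z) {L : ℕ}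
    (hL : 2 / ε ≤ L) :
    ∃ R : Finset V, Disjoint R Z ∧ #R ≤ 1 + #D * (2 * L + 1) ∧ c ∈ R ∧
      ∀ d ∈ D, ∃ p : G.Walk d c, p.IsPath ∧ ∀ w ∈ p.support, w ∈ R := by
  have h : ∀ d : V, ∃ S : Finset V, #S ≤ 2 * L + 1 ∧ Disjoint S Z ∧ (d ∈ D →
      ∃ p : G.Walk d c, p.IsPath ∧ ∀ w ∈ p.support, w ∈ S) := by
    intro d
    by_cases hd : d ∈ D
    · obtain ⟨p, h1, h2, h3⟩ := hG.exists_path_avoiding hε hZ (disjoint_left.mp hD hd) hc hL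
      refine ⟨p.support.toFinset, ?_, ?_, fun _ => ⟨p, h1, by simp⟩⟩
      · refine (List.toFinset_card_le _).trans ?_
        rw [SimpleGraph.Walk.length_support]
        omega
      · rw [disjoint_left]
        simpa using h3
    · exact ⟨∅, by simp, by simp, fun h => absurd h hd⟩
  choose S h1 h2 h3 using h
  refine ⟨insert c (D.biUnion S), ?_, ?_, mem_insert_self _ _, fun d hd => ?_⟩
  · rw [disjoint_insert_left, disjoint_biUnion_left]
    exact ⟨hc, fun d _ => h2 d⟩
  · refine (card_insert_le _ _).trans ?_
    have := card_biUnion_le_card_mul D S (2 * L + 1) fun d _ => h1 d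
    omega
  · obtain ⟨p, hp, hp'⟩ := h3 d hd
    exact ⟨p, hp, fun w hw => mem_insert_of_mem (mem_biUnion.mpr ⟨d, hd, hp' w hw⟩)⟩

/-- A bounded set `D` avoiding `Z` such that few adjacent pairs meet the set of vertices without a
neighbour in `D`. -/
theorem exists_dominating (G : SimpleGraph V) (Z : Finset V) {β : ℝ} (hβ : 0 < β) :
    ∃ D X : Finset V, Disjoint D Z ∧ #D * β ≤ 1 ∧ (∀ v ∉ X, ∃ d ∈ D, G.Adj v d) ∧
      adjPairs G X univ ≤ β * Fintype.card V ^ 2 + #Z * Fintype.card V := by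
  classical
  rcases isEmpty_or_nonempty V with hV | hV
  · exact ⟨∅, ∅, by simp, by simp, fun v => (hV.false v).elim, by simp [adjPairs]⟩
  have hV : (0 : ℝ) < Fintype.card V := by exact_mod_cast Fintype.card_pos
  let X : Finset V → Finset V := fun D => {v | ∀ d ∈ D, ¬ G.Adj v d}
  have hmem : ∀ D v, v ∈ X D ↔ ∀ d ∈ D, ¬ G.Adj v d := fun D v => by simp [X]
  obtain ⟨D, hD, hmin⟩ := exists_min_image (Zᶜ.powerset)
    (fun D => (#(X D) : ℝ) + β * Fintype.card V * #D) ⟨∅, by simp⟩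
  rw [mem_powerset] at hD
  have hDZ : Disjoint D Z := disjoint_left.mpr fun v hv => mem_compl.mp (hD hv)
  refine ⟨D, X D, hDZ, ?_, ?_, ?_⟩
  · have h0 := hmin ∅ (by simp)
    have h1 : (#(X ∅) : ℝ) ≤ Fintype.card V := by exact_mod_cast card_le_univ _
    simp only [card_empty, Nat.cast_zero, mul_zero, add_zero] at h0
    have h2 : (#D * β) * Fintype.card V ≤ 1 * Fintype.card V := by
      nlinarith [Nat.cast_nonneg (α := ℝ) #(X D)]
    exact le_of_mul_le_mul_right h2 hV
  · intro v hv
    rw [hmem] at hv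
    push Not at hv
    exact hv
  · have hw : ∀ w ∈ Zᶜ, adjPairs G {w} (X D) ≤ β * Fintype.card V := by
      intro w hw
      rw [adjPairs_singleton]
      have h1 := hmin (insert w D) (by rw [mem_powerset]; exact insert_subset hw hD)
      have h2 : #(X (insert w D)) + #{v ∈ X D | G.Adj w v} = #(X D) := by
        rw [← card_filter_add_card_filter_not (s := X D) (fun v => G.Adj w v), add_comm]
        congr 2
        ext v
        simp only [mem_filter, hmem, mem_insert, forall_eq_or_imp, G.adj_comm v w]
        tauto
      have h3 : (#(X (insert w D)) : ℝ) + #{v ∈ X D | G.Adj w v} = #(X D) := by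
        exact_mod_cast h2
      have h4 : (#(insert w D) : ℝ) ≤ #D + 1 := by exact_mod_cast card_insert_le _ _
      have h5 := mul_le_mul_of_nonneg_left h4 (by positivity : 0 ≤ β * Fintype.card V)
      linarith
    have hsum : adjPairs G Zᶜ (X D) ≤ #Zᶜ * (β * Fintype.card V) := by
      have : adjPairs G Zᶜ (X D) = ∑ w ∈ Zᶜ, adjPairs G {w} (X D) := by
        simp [adjPairs]
      rw [this, ← nsmul_eq_mul]
      exact sum_le_card_nsmul _ _ _ hw
    have h6 := adjPairs_union_right G (disjoint_compl_right (a := Z)) (X D)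
    rw [union_compl, adjPairs_comm G (X D) Zᶜ] at h6
    have h7 := adjPairs_le_mul G (X D) Z
    have h8 : (#(X D) : ℝ) ≤ Fintype.card V := by exact_mod_cast card_le_univ _
    have h9 : (#Zᶜ : ℝ) ≤ Fintype.card V := by exact_mod_cast card_le_univ _
    rw [h6]
    have h10 := mul_le_mul_of_nonneg_right h8 (Nat.cast_nonneg (α := ℝ) #Z)
    have h11 := mul_le_mul_of_nonneg_right h9 (by positivity : 0 ≤ β * Fintype.card V)
    nlinarith

end CutDense

section Core

variable {V : Type*} {G : SimpleGraph V}

/-- Two disjoint hubs attached to the ends of an even path whose ends are adjacent let one close up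
a long path to an odd cycle. -/
lemma exists_odd_cycle_of_hubs {U' R₁ R₂ C : Finset V} {c₁ c₂ x y x' y' : V}
    (p : G.Walk x y) (hp : p.IsPath) (hpU : ∀ w ∈ p.support, w ∈ U')
    (q : G.Walk c₁ c₂) (hq : q.IsPath) (hqe : Even q.length) (hqC : ∀ w ∈ q.support, w ∈ C)
    (hc : G.Adj c₁ c₂)
    (a : G.Walk x' c₁) (ha : a.IsPath) (haR : ∀ w ∈ a.support, w ∈ R₁)
    (b : G.Walk y' c₂) (hb : b.IsPath) (hbR : ∀ w ∈ b.support, w ∈ R₂)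
    (hx : G.Adj x x') (hy : G.Adj y y')
    (h₁ : ∀ w ∈ R₁, w ∈ C → w = c₁) (h₂ : ∀ w ∈ R₂, w ∈ C → w = c₂)
    (h₁₂ : ∀ w ∈ R₁, w ∉ R₂) (hU₁ : ∀ w ∈ U', w ∉ R₁) (hU₂ : ∀ w ∈ U', w ∉ R₂)
    (hUC : ∀ w ∈ U', w ∉ C) :
    ∃ (v : V) (w : G.Walk v v), w.IsCycle ∧ Odd w.length ∧ p.length < w.length := by
  have key : ∀ m : G.Walk c₁ c₂, m.IsPath → (∀ w ∈ m.support, w ∈ C) →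
      ∃ (v : V) (w : G.Walk v v), w.IsCycle ∧
        w.length = p.length + a.length + b.length + m.length + 2 := by
    intro m hm hmC
    have hmb : (m.append b.reverse).IsPath := hm.append_of_disjoint hb.reverse fun w hw hw' => by
      rw [SimpleGraph.Walk.support_reverse, List.mem_reverse] at hw'
      exact h₂ w (hbR w hw') (hmC w hw)
    have hP : (a.append (m.append b.reverse)).IsPath := ha.append_of_disjoint hmb
      fun w hw hw' => by
        rw [SimpleGraph.Walk.mem_support_append_iff, SimpleGraph.Walk.support_reverse,
          List.mem_reverse] at hw'
        rcases hw' with hw' | hw'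
        · exact h₁ w (haR w hw) (hmC w hw')
        · exact absurd (hbR w hw') (h₁₂ w (haR w hw))
    set P := a.append (m.append b.reverse) with hPdef
    have hPlen : P.length = a.length + (m.length + b.length) := by
      simp [hPdef]
    have hPU : ∀ w ∈ P.support, w ∉ U' := by
      intro w hw hwU
      rw [hPdef, SimpleGraph.Walk.mem_support_append_iff,
        SimpleGraph.Walk.mem_support_append_iff, SimpleGraph.Walk.support_reverse,
        List.mem_reverse] at hw
      rcases hw with hw | hw | hw
      · exact hU₁ w hwU (haR w hw)
      · exact hUC w hwU (hmC w hw)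
      · exact hU₂ w hwU (hbR w hw)
    have hyU : y ∉ P.reverse.support := by
      rw [SimpleGraph.Walk.support_reverse, List.mem_reverse]
      exact fun h => hPU y h (hpU y p.end_mem_support)
    have hN : (p.append (.cons hy P.reverse)).IsPath := by
      refine hp.append_of_disjoint (hP.reverse.cons hyU) fun w hw hw' => ?_
      rw [SimpleGraph.Walk.support_cons, List.mem_cons, SimpleGraph.Walk.support_reverse,
        List.mem_reverse] at hw'
      exact hw'.elim id fun h => absurd (hpU w hw) (hPU w h)
    have hm0 : m.length ≠ 0 := fun h => hc.ne (SimpleGraph.Walk.eq_of_length_eq_zero h)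
    refine ⟨x', .cons hx.symm (p.append (.cons hy P.reverse)), ?_, ?_⟩
    · rw [SimpleGraph.Walk.cons_isCycle_iff]
      refine ⟨hN, fun h => ?_⟩
      rw [Sym2.eq_swap] at h
      have := hN.length_eq_one_of_mem_edges h
      simp only [SimpleGraph.Walk.length_append, SimpleGraph.Walk.length_cons,
        SimpleGraph.Walk.length_reverse] at this
      omega
    · simp only [SimpleGraph.Walk.length_append, SimpleGraph.Walk.length_cons,
        SimpleGraph.Walk.length_reverse]
      omega
  by_cases hpar : Even (p.length + a.length + b.length)
  · obtain ⟨v, w, h, hlen⟩ := key hc.toWalk (SimpleGraph.Walk.IsPath.of_adj hc) (by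
      intro w hw
      rw [SimpleGraph.Adj.toWalk, SimpleGraph.Walk.support_cons] at hw
      simp only [SimpleGraph.Walk.support_nil, List.mem_cons, List.not_mem_nil, or_false] at hw
      rcases hw with rfl | rfl
      · exact hqC _ q.start_mem_support
      · exact hqC _ q.end_mem_support)
    refine ⟨v, w, h, ?_, by omega⟩
    rw [hlen, SimpleGraph.Adj.toWalk, SimpleGraph.Walk.length_cons, SimpleGraph.Walk.length_nil]
    grind
  · obtain ⟨v, w, h, hlen⟩ := key q hq hqC
    refine ⟨v, w, h, ?_, by omega⟩
    rw [hlen]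
    grind

lemma adjPairs_union_le [DecidableEq V] (X Y Z : Finset V) :
    adjPairs G (X ∪ Y) Z ≤ adjPairs G X Z + adjPairs G Y Z := by
  rw [← union_sdiff_self_eq_union, adjPairs_union_left G disjoint_sdiff]
  gcongr
  exact adjPairs_mono G sdiff_subset subset_rfl

variable [Fintype V] [DecidableEq V] {ε : ℝ}

/-- A non-bipartite graph with dense cuts has a short path of even length whose ends are
adjacent. -/
lemma CutDense.exists_even_path (hG : CutDense G ε) (hε : 0 < ε)
    (hnb : ∀ f : V → Prop, ∃ a b, G.Adj a b ∧ (f a ↔ f b)) {L : ℕ} (hL : 2 / ε ≤ L) :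
    ∃ a b : V, ∃ q : G.Walk a b, G.Adj a b ∧ q.IsPath ∧ Even q.length ∧
      q.length ≤ 4 * L + 1 := by
  obtain ⟨r, -⟩ := hnb fun _ => True
  have h := fun v : V => hG.exists_path_avoiding hε (Z := ∅) (x := r) (y := v)
    (by simp only [card_empty, Nat.cast_zero]; positivity) (by simp) (by simp) hL
  choose p _ hp _ using h
  obtain ⟨a, b, hab, hpar⟩ := hnb fun v => Even (p v).length
  obtain ⟨c, d, q, h1, h2, h3, h4⟩ :=
    ((p a).append (.cons hab (p b).reverse)).exists_even_path_of_odd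
    (by
      rw [SimpleGraph.Walk.length_append, SimpleGraph.Walk.length_cons,
        SimpleGraph.Walk.length_reverse]
      grind)
  refine ⟨c, d, q, h1, h2, h3, h4.trans ?_⟩
  rw [SimpleGraph.Walk.length_append, SimpleGraph.Walk.length_cons,
    SimpleGraph.Walk.length_reverse]
  have := hp a
  have := hp b
  omega

lemma adjPairs_le_sdiff (U Y : Finset V) :
    adjPairs G U U ≤ adjPairs G (U \ Y) (U \ Y) + 2 * adjPairs G Y univ := by
  have h := adjPairs_union_self G (disjoint_sdiff_inter U Y)
  rw [sdiff_union_inter] at h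
  have h1 := adjPairs_union_right G (disjoint_sdiff_inter U Y) (U ∩ Y)
  rw [sdiff_union_inter, adjPairs_comm G (U ∩ Y) (U \ Y)] at h1
  have h2 : adjPairs G (U ∩ Y) U ≤ adjPairs G Y univ :=
    adjPairs_mono G inter_subset_right (subset_univ _)
  have h3 := adjPairs_nonneg G (U ∩ Y) (U ∩ Y)
  linarith

/-- In a large non-bipartite graph with dense cuts and without long odd cycles, every set of
vertices spans few edges. -/
theorem CutDense.adjPairs_le (hG : CutDense G ε) (hε : 0 < ε) (hε1 : ε ≤ 1)
    (hnb : ∀ f : V → Prop, ∃ a b, G.Adj a b ∧ (f a ↔ f b))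
    (hV : 1536 / ε ^ 3 ≤ Fintype.card V) {n : ℕ}
    (hn : ∀ (v : V) (w : G.Walk v v), w.IsCycle → Odd w.length → w.length < n)
    (U : Finset V) : adjPairs G U U ≤ n * #U + ε * Fintype.card V ^ 2 := by
  have hm : (0 : ℝ) < Fintype.card V := lt_of_lt_of_le (by positivity) hV
  set m : ℝ := (Fintype.card V : ℝ)
  obtain ⟨L, hL⟩ : ∃ L : ℕ, L = ⌈2 / ε⌉₊ := ⟨_, rfl⟩
  have hL1 : 2 / ε ≤ L := hL ▸ Nat.le_ceil _
  have hinv : 1 ≤ 1 / ε := by rwa [le_div_iff₀ hε, one_mul]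
  obtain ⟨e, he⟩ : ∃ e : ℝ, e = 1 / ε := ⟨_, rfl⟩
  rw [← he] at hinv
  have heps : e * ε = 1 := by rw [he]; field_simp
  have hL2 : (L : ℝ) ≤ 3 * e := by
    have := (Nat.ceil_lt_add_one (by positivity : 0 ≤ 2 / ε)).le
    rw [← hL] at this
    have h2 : 2 / ε = 2 * e := by rw [he]; ring
    linarith
  have hQm : 128 * e ^ 2 ≤ ε * m / 12 := by
    have h1 : 1536 / ε ^ 3 = 1536 * e ^ 3 := by rw [he]; field_simp
    rw [h1] at hV
    have h2 := mul_le_mul_of_nonneg_left hV hε.le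
    have h3 : ε * (1536 * e ^ 3) = 1536 * e ^ 2 := by
      linear_combination 1536 * e ^ 2 * heps
    linarith
  obtain ⟨c₁, c₂, q, hc, hq, hqe, hql⟩ := hG.exists_even_path hε hnb hL1
  obtain ⟨C, hCdef⟩ : ∃ C : Finset V, C = q.support.toFinset := ⟨_, rfl⟩
  have hqC : ∀ w ∈ q.support, w ∈ C := by simp [hCdef]
  have hCn : #C ≤ 4 * L + 2 := by
    rw [hCdef]
    refine (List.toFinset_card_le _).trans ?_
    rw [SimpleGraph.Walk.length_support]
    omega
  have hC : (#C : ℝ) ≤ 14 * e := by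
    have : (#C : ℝ) ≤ 4 * L + 2 := by exact_mod_cast hCn
    linarith
  have hR : ∀ D R : Finset V, #D * (ε / 8) ≤ 1 → #R ≤ 1 + #D * (2 * L + 1) →
      (#R : ℝ) ≤ 57 * e ^ 2 := by
    intro D R hD hDR
    have h1 : (#R : ℝ) ≤ 1 + #D * (2 * L + 1) := by exact_mod_cast hDR
    have h2 : (#D : ℝ) ≤ 8 * e := by
      have := mul_le_mul_of_nonneg_left hD (by linarith : 0 ≤ 8 * e)
      have h3 : 8 * e * (#D * (ε / 8)) = #D := by linear_combination #D * heps
      linarith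
    have h3 : (#D : ℝ) * (2 * L + 1) ≤ (8 * e) * (7 * e) :=
      mul_le_mul h2 (by linarith) (by positivity) (by linarith)
    nlinarith
  obtain ⟨D₁, X₁, hD₁, hD₁c, hX₁, hX₁e⟩ := exists_dominating G C (by positivity : 0 < ε / 8)
  obtain ⟨R₁, hR₁, hR₁c, hc₁R, hlink₁⟩ := hG.exists_hub hε (Z := C.erase c₁) (D := D₁) (c := c₁)
    (by
      have : (#(C.erase c₁) : ℝ) ≤ #C := by exact_mod_cast card_erase_le
      change _ ≤ ε * m / 4
      nlinarith) (notMem_erase _ _) (hD₁.mono_right (erase_subset _ _)) hL1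
  have hR₁' := hR D₁ R₁ hD₁c hR₁c
  have hCR : (#(C ∪ R₁) : ℝ) ≤ #C + #R₁ := by exact_mod_cast card_union_le _ _
  obtain ⟨D₂, X₂, hD₂, hD₂c, hX₂, hX₂e⟩ :=
    exists_dominating G (C ∪ R₁) (by positivity : 0 < ε / 8)
  have hc₂R₁ : c₂ ∉ R₁ := fun h => disjoint_left.mp hR₁ h
    (mem_erase.mpr ⟨hc.ne', hqC _ q.end_mem_support⟩)
  obtain ⟨R₂, hR₂, hR₂c, hc₂R, hlink₂⟩ := hG.exists_hub hε (Z := (C ∪ R₁).erase c₂) (D := D₂)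
    (c := c₂)
    (by
      have : (#((C ∪ R₁).erase c₂) : ℝ) ≤ #(C ∪ R₁) := by exact_mod_cast card_erase_le
      change _ ≤ ε * m / 4
      nlinarith) (notMem_erase _ _) (hD₂.mono_right (erase_subset _ _)) hL1
  have hR₂' := hR D₂ R₂ hD₂c hR₂c
  obtain ⟨Q, hQ⟩ : ∃ Q : Finset V, Q = C ∪ R₁ ∪ R₂ := ⟨_, rfl⟩
  have hQc : (#Q : ℝ) ≤ #(C ∪ R₁) + #R₂ := by
    rw [hQ]
    exact_mod_cast card_union_le _ _
  have hQ' : (#Q : ℝ) ≤ ε * m / 12 := by nlinarith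
  obtain ⟨U', hU'⟩ : ∃ U' : Finset V, U' = U \ (Q ∪ X₁ ∪ X₂) := ⟨_, rfl⟩
  by_contra! hcon
  have hbig : (n : ℝ) * #U' < adjPairs G U' U' := by
    have h1 := adjPairs_le_sdiff (G := G) U (Q ∪ X₁ ∪ X₂)
    rw [← hU'] at h1
    have h2 := adjPairs_union_le (G := G) (Q ∪ X₁) X₂ univ
    have h3 := adjPairs_union_le (G := G) Q X₁ univ
    have h4 := adjPairs_le_mul G Q univ
    rw [card_univ] at h4
    have h5 : (#U' : ℝ) ≤ #U := by
      rw [hU']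
      exact_mod_cast card_le_card sdiff_subset
    have h6 := mul_le_mul_of_nonneg_left h5 (Nat.cast_nonneg (α := ℝ) n)
    change _ ≤ #Q * m at h4
    change _ ≤ ε / 8 * m ^ 2 + _ * m at hX₁e
    change _ ≤ ε / 8 * m ^ 2 + _ * m at hX₂e
    have h7 : (#C : ℝ) ≤ #Q := by
      rw [hQ, union_assoc]; exact_mod_cast card_le_card subset_union_left
    have h8 : (#(C ∪ R₁) : ℝ) ≤ #Q := by
      rw [hQ]; exact_mod_cast card_le_card subset_union_left
    have h9 := mul_le_mul_of_nonneg_right (h7.trans hQ') hm.le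
    have h10 := mul_le_mul_of_nonneg_right (h8.trans hQ') hm.le
    have h11 := mul_le_mul_of_nonneg_right hQ' hm.le
    have h12 : ε * m / 12 * m = ε * m ^ 2 / 12 := by ring
    rw [h12] at h9 h10 h11
    linarith
  obtain ⟨l, hnd, hch, hlU, hlen⟩ : ∃ l : List V, l.Nodup ∧ l.IsChain G.Adj ∧
      (∀ v ∈ l, v ∈ U') ∧ n < l.length := by
    by_contra! h
    exact absurd (adjPairs_le_of_forall_path_length_le G n U' h) (not_le.mpr hbig)
  have hne : l ≠ [] := by rintro rfl; simp at hlen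
  have hsup := SimpleGraph.Walk.support_ofSupport hne hch
  have hlenW := SimpleGraph.Walk.length_ofSupport hne hch
  set p := SimpleGraph.Walk.ofSupport l hne hch
  have hp : p.IsPath := by rw [SimpleGraph.Walk.isPath_def, hsup]; exact hnd
  have hpU : ∀ w ∈ p.support, w ∈ U' := by rw [hsup]; exact hlU
  have hmemU : ∀ w ∈ U', w ∉ C ∧ w ∉ R₁ ∧ w ∉ R₂ ∧ w ∉ X₁ ∧ w ∉ X₂ := by
    intro w hw
    rw [hU', hQ] at hw
    simp only [mem_sdiff, mem_union, not_or] at hw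
    tauto
  obtain ⟨x', hx'D, hx'⟩ := hX₁ _ (hmemU _ (hpU _ p.start_mem_support)).2.2.2.1
  obtain ⟨y', hy'D, hy'⟩ := hX₂ _ (hmemU _ (hpU _ p.end_mem_support)).2.2.2.2
  obtain ⟨a, ha, haR⟩ := hlink₁ x' hx'D
  obtain ⟨b, hb, hbR⟩ := hlink₂ y' hy'D
  rw [disjoint_left] at hR₁ hR₂
  obtain ⟨v, w, h1, h2, h3⟩ := exists_odd_cycle_of_hubs p hp hpU q hq hqe hqC hc a ha haR b hb hbR
    hx' hy'
    (fun w hw hwC => by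
      by_contra h
      exact hR₁ hw (mem_erase.mpr ⟨h, hwC⟩))
    (fun w hw hwC => by
      by_contra h
      exact hR₂ hw (mem_erase.mpr ⟨h, mem_union_left _ hwC⟩))
    (fun w hw hw' => hR₂ hw' (mem_erase.mpr
      ⟨fun h => hc₂R₁ (h ▸ hw), mem_union_right _ hw⟩))
    (fun w hw => (hmemU w hw).2.1) (fun w hw => (hmemU w hw).2.2.1)
    (fun w hw => (hmemU w hw).1)
  have := hn v w h1 h2
  omega

end Core

section Partition

variable {V : Type*} {G : SimpleGraph V} {ε : ℝ}

lemma adjPairs_comap_val {W : Finset V} (X Y : Finset W) :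
    adjPairs (G.comap (Subtype.val : W → V)) X Y =
      adjPairs G (X.map (.subtype _)) (Y.map (.subtype _)) := by
  unfold adjPairs
  rw [sum_map]
  refine sum_congr rfl fun x _ => ?_
  rw [sum_map]
  rfl

variable [DecidableEq V]

/-- The bound of `CutDense.adjPairs_le` for the subgraph induced on a set `W` of vertices. -/
lemma adjPairs_le_of_dense_cuts (hε : 0 < ε) (hε1 : ε ≤ 1) {W : Finset V}
    (hG : ∀ X ⊆ W, ε * #X * #(W \ X) ≤ adjPairs G X (W \ X))
    (hnb : ∀ f : V → Prop, ∃ a ∈ W, ∃ b ∈ W, G.Adj a b ∧ (f a ↔ f b))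
    (hW : 1536 / ε ^ 3 ≤ #W) {n : ℕ}
    (hn : ∀ (v : V) (w : G.Walk v v), w.IsCycle → Odd w.length → w.length < n)
    {U : Finset V} (hU : U ⊆ W) : adjPairs G U U ≤ n * #U + ε * #W ^ 2 := by
  have hmap : ∀ X ⊆ W, (X.subtype (· ∈ W)).map (.subtype _) = X := by
    intro X hX
    rw [subtype_map, filter_true_of_mem fun x hx => hX hx]
  have hdense : CutDense (G.comap (Subtype.val : W → V)) ε := by
    intro X
    have hX : X.map (.subtype _) ⊆ W := by
      intro v hv
      rw [mem_map] at hv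
      obtain ⟨x, -, rfl⟩ := hv
      exact x.2
    have hXc : Xᶜ.map (.subtype _) = W \ X.map (.subtype _) := by
      ext v
      simp only [mem_map, mem_compl, mem_sdiff, Function.Embedding.subtype_apply, Subtype.exists,
        exists_and_right, exists_eq_right]
      grind
    have h := hG _ hX
    rw [← hXc, card_map, card_map] at h
    rwa [adjPairs_comap_val]
  have h := hdense.adjPairs_le hε hε1 (fun f => by
      obtain ⟨a, ha, b, hb, hab, hf⟩ := hnb fun v => ∃ h : v ∈ W, f ⟨v, h⟩
      refine ⟨⟨a, ha⟩, ⟨b, hb⟩, hab, ?_⟩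
      simpa [ha, hb] using hf) (by simpa using hW) (n := n) (fun v w hw ho => by
      have := hn _ (w.map (⟨Subtype.val, id⟩ : G.comap (Subtype.val : W → V) →g G))
        (hw.map Subtype.val_injective) (by rwa [SimpleGraph.Walk.length_map])
      rwa [SimpleGraph.Walk.length_map] at this) (U.subtype (· ∈ W))
  rw [adjPairs_comap_val, hmap U hU, Fintype.card_coe,
    ← card_map (.subtype (· ∈ W)) (s := U.subtype (· ∈ W)), hmap U hU] at h
  exact h

/-- In a graph without long odd cycles, every set of vertices splits, up to few edges, into a
bipartite part and a part spanning few edges. -/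
theorem exists_bipartite_sparse_partition (hε : 0 < ε) (hε1 : ε ≤ 1) {n : ℕ}
    (hbig : 1536 / ε ^ 3 ≤ n)
    (hn : ∀ (v : V) (w : G.Walk v v), w.IsCycle → Odd w.length → w.length < n) (W : Finset V) :
    ∃ A B S : Finset V, Disjoint A B ∧ Disjoint (A ∪ B) S ∧ A ∪ B ∪ S = W ∧
      adjPairs G A A + adjPairs G B B + 2 * adjPairs G S (A ∪ B) ≤ ε * #W ^ 2 ∧
      ∀ U ⊆ S, adjPairs G U U ≤ n * #U + ε * #W ^ 2 := by
  induction W using Finset.strongInduction with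
  | H W ih =>
  by_cases hcut : ∀ X ⊆ W, ε * #X * #(W \ X) ≤ adjPairs G X (W \ X)
  · by_cases hnb : ∀ f : V → Prop, ∃ a ∈ W, ∃ b ∈ W, G.Adj a b ∧ (f a ↔ f b)
    · refine ⟨∅, ∅, W, by simp, by simp, by simp, ?_, fun U hU => ?_⟩
      · simp only [adjPairs, sum_empty, union_empty, sum_const_zero, mul_zero, add_zero]
        positivity
      rcases le_total n #W with h | h
      · refine adjPairs_le_of_dense_cuts hε hε1 hcut hnb (hbig.trans ?_) hn hU
        exact_mod_cast h
      · have h1 := adjPairs_le_mul G U U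
        have h2 : (#U : ℝ) ≤ n := by exact_mod_cast (card_le_card hU).trans h
        have h3 := mul_le_mul_of_nonneg_right h2 (Nat.cast_nonneg (α := ℝ) #U)
        have h4 : 0 ≤ ε * (#W : ℝ) ^ 2 := by positivity
        linarith
    · classical
      push Not at hnb
      obtain ⟨f, hf⟩ := hnb
      refine ⟨{v ∈ W | f v}, {v ∈ W | ¬ f v}, ∅, disjoint_filter_filter_not _ _ _, by simp,
        by rw [union_empty, filter_union_filter_not_eq], ?_, fun U hU => ?_⟩
      · rw [adjPairs_eq_zero G, adjPairs_eq_zero G, adjPairs_eq_zero G]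
        · simp only [add_zero, mul_zero]
          positivity
        · simp
        · intro x hx y hy hxy
          rw [mem_filter] at hx hy
          have := hf x hx.1 y hy.1 hxy
          tauto
        · intro x hx y hy hxy
          rw [mem_filter] at hx hy
          have := hf x hx.1 y hy.1 hxy
          tauto
      · rw [subset_empty.mp hU, adjPairs_eq_zero G (by simp)]
        positivity
  · push Not at hcut
    obtain ⟨X, hXW, hX⟩ := hcut
    obtain ⟨Y, hY⟩ : ∃ Y, Y = W \ X := ⟨_, rfl⟩
    rw [← hY] at hX
    have hXY : Disjoint X Y := hY ▸ disjoint_sdiff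
    have hWu : X ∪ Y = W := by rw [hY, union_sdiff_of_subset hXW]
    have hpos := (adjPairs_nonneg G X Y).trans_lt hX
    have hX0 : X.Nonempty := by
      rw [nonempty_iff_ne_empty]; rintro rfl; simp at hpos
    have hY0 : Y.Nonempty := by
      rw [nonempty_iff_ne_empty]; intro h; simp [h] at hpos
    have hXW' : X ⊂ W := by
      refine hXW.ssubset_of_ne fun h => hY0.ne_empty ?_
      rw [hY, h, sdiff_self]; rfl
    have hYW' : Y ⊂ W := by
      rw [hY]
      exact sdiff_ssubset hXW hX0
    have hcard : (#W : ℝ) = #X + #Y := by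
      rw [← hWu, card_union_of_disjoint hXY]; push_cast; rfl
    obtain ⟨A₁, B₁, S₁, hAB₁, hS₁, hu₁, he₁, hs₁⟩ := ih X hXW'
    obtain ⟨A₂, B₂, S₂, hAB₂, hS₂, hu₂, he₂, hs₂⟩ := ih Y hYW'
    have hd : ∀ P ⊆ X, ∀ R ⊆ Y, Disjoint P R := fun P hP R hR =>
      (hXY.mono_left hP).mono_right hR
    have hA₁ : A₁ ⊆ X := by rw [← hu₁, union_assoc]; exact subset_union_left
    have hAB₁' : A₁ ∪ B₁ ⊆ X := by rw [← hu₁]; exact subset_union_left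
    have hB₁ : B₁ ⊆ X := subset_union_right.trans hAB₁'
    have hS₁' : S₁ ⊆ X := by rw [← hu₁]; exact subset_union_right
    have hA₂ : A₂ ⊆ Y := by rw [← hu₂, union_assoc]; exact subset_union_left
    have hAB₂' : A₂ ∪ B₂ ⊆ Y := by rw [← hu₂]; exact subset_union_left
    have hB₂ : B₂ ⊆ Y := subset_union_right.trans hAB₂'
    have hS₂' : S₂ ⊆ Y := by rw [← hu₂]; exact subset_union_right
    have hABu : A₁ ∪ A₂ ∪ (B₁ ∪ B₂) = A₁ ∪ B₁ ∪ (A₂ ∪ B₂) := union_union_union_comm _ _ _ _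
    refine ⟨A₁ ∪ A₂, B₁ ∪ B₂, S₁ ∪ S₂, ?_, ?_, ?_, ?_, fun U hU => ?_⟩
    · simp only [disjoint_union_left, disjoint_union_right]
      exact ⟨⟨hAB₁, (hd _ hB₁ _ hA₂).symm⟩, hd _ hA₁ _ hB₂, hAB₂⟩
    · rw [hABu, disjoint_union_left, disjoint_union_right, disjoint_union_right]
      exact ⟨⟨hS₁, hd _ hAB₁' _ hS₂'⟩, (hd _ hS₁' _ hAB₂').symm, hS₂⟩
    · rw [hABu, union_union_union_comm, hu₁, hu₂, hWu]
    · rw [hABu, adjPairs_union_self G (hd _ hA₁ _ hA₂), adjPairs_union_self G (hd _ hB₁ _ hB₂),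
        adjPairs_union_left G (hd _ hS₁' _ hS₂'), adjPairs_union_right G (hd _ hAB₁' _ hAB₂'),
        adjPairs_union_right G (hd _ hAB₁' _ hAB₂'), hcard]
      have hblock : adjPairs G A₁ A₂ + adjPairs G B₁ B₂ + adjPairs G S₁ (A₂ ∪ B₂) +
          adjPairs G S₂ (A₁ ∪ B₁) ≤ adjPairs G X Y := by
        rw [← hu₁, ← hu₂, adjPairs_union_left G hS₁, adjPairs_union_right G hS₂,
          adjPairs_union_right G hS₂, adjPairs_comm G S₂, adjPairs_union_left G hAB₁ (A₂ ∪ B₂),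
          adjPairs_union_right G hAB₂ A₁, adjPairs_union_right G hAB₂ B₁]
        have h1 := adjPairs_nonneg G A₁ B₂
        have h2 := adjPairs_nonneg G B₁ A₂
        have h3 := adjPairs_nonneg G S₁ S₂
        linarith
      nlinarith
    · have hU₁ : U ∩ X ⊆ S₁ := by
        intro v hv
        rw [mem_inter] at hv
        exact (mem_union.mp (hU hv.1)).resolve_right fun h =>
          disjoint_left.mp hXY hv.2 (hS₂' h)
      have hU₂ : U ∩ Y ⊆ S₂ := by
        intro v hv
        rw [mem_inter] at hv
        exact (mem_union.mp (hU hv.1)).resolve_left fun h =>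
          disjoint_left.mp hXY (hS₁' h) hv.2
      have hUu : U = U ∩ X ∪ U ∩ Y := by
        rw [← inter_union_distrib_left, hWu, inter_eq_left.mpr]
        rw [← hWu]
        exact hU.trans (union_subset_union hS₁' hS₂')
      have hUd : Disjoint (U ∩ X) (U ∩ Y) := hd _ inter_subset_right _ inter_subset_right
      have h1 := hs₁ _ hU₁
      have h2 := hs₂ _ hU₂
      have h3 := adjPairs_mono G (inter_subset_right (s₁ := U) (s₂ := X))
        (inter_subset_right (s₁ := U) (s₂ := Y))
      have h4 : (#U : ℝ) = #(U ∩ X) + #(U ∩ Y) := by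
        exact_mod_cast (congrArg card hUu).trans (card_union_of_disjoint hUd)
      rw [h4, hcard]
      rw [hUu, adjPairs_union_self G hUd, ← hUu]
      nlinarith

end Partition

section Counting

variable {V : Type*}

open scoped Classical in
/-- The indicator of the adjacent pairs in `X × Y`. -/
noncomputable def adjInd (G : SimpleGraph V) (X Y : Finset V) (u v : V) : ℝ :=
  if u ∈ X ∧ v ∈ Y ∧ G.Adj u v then 1 else 0

lemma adjInd_nonneg (G : SimpleGraph V) (X Y : Finset V) (u v : V) : 0 ≤ adjInd G X Y u v := by
  unfold adjInd
  split_ifs <;> norm_num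

lemma adjInd_eq_one {G : SimpleGraph V} {X Y : Finset V} {u v : V} (hu : u ∈ X) (hv : v ∈ Y)
    (h : G.Adj u v) : adjInd G X Y u v = 1 := if_pos ⟨hu, hv, h⟩

lemma prod_one_add_le {x y : Fin 3 → ℝ} (hx : ∀ i, |x i| ≤ 1) (hy : ∀ i, |y i| ≤ 1)
    {Z : Finset (Fin 3)} (hZ : ∀ i ∈ Z, x i = 0) :
    ∏ i, (1 + x i * y i) ≤ 2 ^ (3 - #Z) := by
  have hxy : ∀ i, |x i * y i| ≤ 1 := fun i => by
    rw [abs_mul]; exact mul_le_one₀ (hx i) (abs_nonneg _) (hy i)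
  calc ∏ i, (1 + x i * y i) ≤ ∏ i, if i ∈ Z then (1 : ℝ) else 2 := by
        refine prod_le_prod (fun i _ => ?_) fun i _ => ?_
        · linarith [(abs_le.mp (hxy i)).1]
        · split_ifs with h
          · simp [hZ i h]
          · linarith [(abs_le.mp (hxy i)).2]
    _ = 2 ^ (3 - #Z) := by
      rw [prod_ite, prod_const_one, one_mul, prod_const, filter_not, filter_mem_eq_inter,
        univ_inter, ← compl_eq_univ_sdiff, card_compl, Fintype.card_fin]

variable [DecidableEq V] {G : Fin 3 → SimpleGraph V} {A B S : Fin 3 → Finset V}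

/-- The labelling of the vertices by `1` on `A`, `-1` on `B` and `0` elsewhere. -/
noncomputable def label (A B : Fin 3 → Finset V) (v : V) (i : Fin 3) : ℝ :=
  if v ∈ A i then 1 else if v ∈ B i then -1 else 0

lemma abs_label_le (v : V) (i : Fin 3) : |label A B v i| ≤ 1 := by
  unfold label
  split_ifs <;> norm_num

/-- The indices `i` such that `v` lies in `S i`. -/
def levels (S : Fin 3 → Finset V) (v : V) : Finset (Fin 3) := {i | v ∈ S i}

lemma label_eq_zero (hS : ∀ i, Disjoint (A i ∪ B i) (S i)) {v : V} {i : Fin 3}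
    (h : i ∈ levels S v) : label A B v i = 0 := by
  have h1 := disjoint_right.mp (hS i) (mem_filter.mp h).2
  rw [mem_union, not_or] at h1
  rw [label, if_neg h1.1, if_neg h1.2]

/-- The members of `S i` lying in at most `k` of the sets `S j`. -/
def lowPart (S : Fin 3 → Finset V) (i : Fin 3) (k : ℕ) : Finset V := {v ∈ S i | #(levels S v) ≤ k}

lemma prod_label_le_eight (u v : V) : ∏ i, (1 + label A B u i * label A B v i) ≤ 8 := by
  have h := prod_one_add_le (abs_label_le (A := A) (B := B) u) (abs_label_le (A := A) (B := B) v)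
    (Z := ∅) (by simp)
  norm_num at h
  exact h

lemma prod_label_le_of_mem (hS : ∀ i, Disjoint (A i ∪ B i) (S i)) {u v : V} {i : Fin 3}
    (h : (G i).Adj u v) (hu : u ∈ S i) (hv : v ∈ S i) :
    ∏ i, (1 + label A B u i * label A B v i) ≤
      4 * (adjInd (G i) (lowPart S i 1) (lowPart S i 1) u v / 2 +
        adjInd (G i) (lowPart S i 2) (lowPart S i 2) u v / 6 +
        adjInd (G i) (lowPart S i 3) (lowPart S i 3) u v / 3) := by
  have hu' := prod_one_add_le (abs_label_le (A := A) (B := B) u)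
    (abs_label_le (A := A) (B := B) v) fun j hj => label_eq_zero hS (v := u) hj
  have hv' := prod_one_add_le (abs_label_le (A := A) (B := B) v)
    (abs_label_le (A := A) (B := B) u) fun j hj => label_eq_zero hS (v := v) hj
  simp only [mul_comm (label A B v _)] at hv'
  have hcard : ∀ w ∈ S i, 1 ≤ #(levels S w) ∧ #(levels S w) ≤ 3 := fun w hw =>
    ⟨card_pos.mpr ⟨i, mem_filter.mpr ⟨mem_univ _, hw⟩⟩, card_le_univ _⟩
  have hone : ∀ k, #(levels S u) ≤ k → #(levels S v) ≤ k →
      adjInd (G i) (lowPart S i k) (lowPart S i k) u v = 1 := fun k h1 h2 =>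
    adjInd_eq_one (mem_filter.mpr ⟨hu, h1⟩) (mem_filter.mpr ⟨hv, h2⟩) h
  obtain ⟨hu1, hu3⟩ := hcard u hu
  obtain ⟨hv1, hv3⟩ := hcard v hv
  have n1 := adjInd_nonneg (G i) (lowPart S i 1) (lowPart S i 1) u v
  have n2 := adjInd_nonneg (G i) (lowPart S i 2) (lowPart S i 2) u v
  have e3 := hone 3 hu3 hv3
  have e1 := hone 1
  have e2 := hone 2
  generalize #(levels S u) = a at *
  generalize #(levels S v) = b at *
  rw [e3]
  interval_cases a <;> interval_cases b <;> norm_num at * <;> linarith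

/-- The contribution of the `i`-th graph to the upper bound of the product kernel. -/
noncomputable def excess (G : Fin 3 → SimpleGraph V) (A B S : Fin 3 → Finset V) (i : Fin 3)
    (u v : V) : ℝ :=
  8 * (adjInd (G i) (A i) (A i) u v + adjInd (G i) (B i) (B i) u v +
      adjInd (G i) (S i) (A i ∪ B i) u v + adjInd (G i) (A i ∪ B i) (S i) u v) +
    4 * (adjInd (G i) (lowPart S i 1) (lowPart S i 1) u v / 2 +
      adjInd (G i) (lowPart S i 2) (lowPart S i 2) u v / 6 +
      adjInd (G i) (lowPart S i 3) (lowPart S i 3) u v / 3)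

lemma excess_nonneg (i : Fin 3) (u v : V) : 0 ≤ excess G A B S i u v := by
  unfold excess
  have h := fun X Y => adjInd_nonneg (G i) X Y u v
  have := h (A i) (A i)
  have := h (B i) (B i)
  have := h (S i) (A i ∪ B i)
  have := h (A i ∪ B i) (S i)
  have := h (lowPart S i 1) (lowPart S i 1)
  have := h (lowPart S i 2) (lowPart S i 2)
  have := h (lowPart S i 3) (lowPart S i 3)
  positivity

end Counting

section Fintype

variable {V : Type*} [Fintype V]

lemma adjPairs_univ_eq_twice_card_edgeSet (G : SimpleGraph V) :
    adjPairs G univ univ = 2 * Nat.card G.edgeSet := by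
  classical
  have h := G.sum_degrees_eq_twice_card_edges
  rw [← SimpleGraph.coe_edgeFinset, Nat.card_eq_card_toFinset, toFinset_coe]
  calc adjPairs G univ univ = ∑ v, adjPairs G {v} univ := by simp [adjPairs]
    _ = ∑ v, (G.degree v : ℝ) := by
      refine sum_congr rfl fun v _ => ?_
      rw [adjPairs_singleton, ← SimpleGraph.card_neighborFinset_eq_degree,
        SimpleGraph.neighborFinset_eq_filter]
    _ = _ := by exact_mod_cast h

/-- Expanding the product into squares bounds from below the sum of a product kernel. -/
lemma card_sq_le_sum_prod {ι : Type*} [Fintype ι] (χ : ι → V → ℝ) :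
    (Fintype.card V : ℝ) ^ 2 ≤ ∑ u, ∑ v, ∏ i, (1 + χ i u * χ i v) := by
  classical
  have h : ∑ u, ∑ v, ∏ i, (1 + χ i u * χ i v) =
      ∑ s ∈ (univ : Finset ι).powerset, (∑ u, ∏ i ∈ s, χ i u) ^ 2 := by
    simp only [prod_one_add, prod_mul_distrib, sq, sum_mul_sum]
    rw [sum_congr rfl fun u _ => sum_comm, sum_comm]
  rw [h]
  refine le_trans ?_ (single_le_sum (fun s _ => sq_nonneg _) (empty_mem_powerset _))
  simp

variable [DecidableEq V]

lemma sum_adjInd (G : SimpleGraph V) (X Y : Finset V) :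
    ∑ u, ∑ v, adjInd G X Y u v = adjPairs G X Y := by
  classical
  unfold adjPairs adjInd
  simp only [ite_and, sum_ite_irrel, sum_const_zero, sum_ite_mem, univ_inter]

variable {G : Fin 3 → SimpleGraph V} {A B S : Fin 3 → Finset V}

lemma prod_label_le_excess (hAB : ∀ i, Disjoint (A i) (B i))
    (hS : ∀ i, Disjoint (A i ∪ B i) (S i)) (hu : ∀ i, A i ∪ B i ∪ S i = univ) {u v : V}
    {i : Fin 3} (h : (G i).Adj u v) :
    ∏ i, (1 + label A B u i * label A B v i) ≤ excess G A B S i u v := by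
  have hex := excess_nonneg (G := G) (A := A) (B := B) (S := S) i u v
  have hn := fun X Y => adjInd_nonneg (G i) X Y u v
  have h1 := hn (A i) (A i)
  have h2 := hn (B i) (B i)
  have h3 := hn (S i) (A i ∪ B i)
  have h4 := hn (A i ∪ B i) (S i)
  have h5 := hn (lowPart S i 1) (lowPart S i 1)
  have h6 := hn (lowPart S i 2) (lowPart S i 2)
  have h7 := hn (lowPart S i 3) (lowPart S i 3)
  have h8 := prod_label_le_eight (A := A) (B := B) u v
  have hopp : ∀ x y : V, x ∈ A i → y ∈ B i → 1 + label A B x i * label A B y i = 0 := by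
    intro x y hx hy
    rw [label, label, if_pos hx, if_neg (disjoint_right.mp (hAB i) hy), if_pos hy]
    norm_num
  have hcases : ∀ w, w ∈ A i ∨ w ∈ B i ∨ w ∈ S i := fun w => by
    have := hu i ▸ mem_univ w
    simpa only [mem_union, or_assoc] using this
  rcases hcases u with hu' | hu' | hu' <;> rcases hcases v with hv' | hv' | hv'
  · have := adjInd_eq_one hu' hv' h
    unfold excess; linarith
  · rw [prod_eq_zero (mem_univ i) (hopp u v hu' hv')]
    exact hex
  · have := adjInd_eq_one (mem_union_left (B i) hu') hv' h
    unfold excess; linarith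
  · rw [prod_eq_zero (mem_univ i) (by rw [mul_comm]; exact hopp v u hv' hu')]
    exact hex
  · have := adjInd_eq_one hu' hv' h
    unfold excess; linarith
  · have := adjInd_eq_one (mem_union_right (A i) hu') hv' h
    unfold excess; linarith
  · have := adjInd_eq_one hu' (mem_union_left (B i) hv') h
    unfold excess; linarith
  · have := adjInd_eq_one hu' (mem_union_right (A i) hv') h
    unfold excess; linarith
  · have := prod_label_le_of_mem hS h hu' hv'
    unfold excess; linarith

lemma sum_excess (i : Fin 3) : ∑ u, ∑ v, excess G A B S i u v =
    8 * (adjPairs (G i) (A i) (A i) + adjPairs (G i) (B i) (B i) +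
      2 * adjPairs (G i) (S i) (A i ∪ B i)) +
    4 * (adjPairs (G i) (lowPart S i 1) (lowPart S i 1) / 2 +
      adjPairs (G i) (lowPart S i 2) (lowPart S i 2) / 6 +
      adjPairs (G i) (lowPart S i 3) (lowPart S i 3) / 3) := by
  simp only [excess, sum_add_distrib, ← mul_sum, ← sum_div, sum_adjInd]
  rw [adjPairs_comm (G i) (A i ∪ B i) (S i)]
  ring

lemma sum_card_lowPart_le : ∑ i, ((#(lowPart S i 1) : ℝ) / 2 + #(lowPart S i 2) / 6 +
    #(lowPart S i 3) / 3) ≤ Fintype.card V := by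
  have h : ∀ k, ∑ i, (#(lowPart S i k) : ℝ) =
      ∑ v : V, if #(levels S v) ≤ k then (#(levels S v) : ℝ) else 0 := by
    intro k
    have h1 : ∀ i, (#(lowPart S i k) : ℝ) =
        ∑ v : V, if #(levels S v) ≤ k then (if v ∈ S i then (1 : ℝ) else 0) else 0 := by
      intro i
      rw [← sum_filter, ← sum_filter, sum_const, nsmul_eq_mul, mul_one, filter_filter, lowPart]
      congr 2
      ext v
      simp [and_comm]
    simp only [h1]
    rw [sum_comm]
    refine sum_congr rfl fun v _ => ?_
    split_ifs
    · rw [← sum_filter, sum_const, nsmul_eq_mul, mul_one, levels]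
    · exact sum_const_zero
  rw [sum_add_distrib, sum_add_distrib, ← sum_div, ← sum_div, ← sum_div, h, h, h, sum_div, sum_div,
    sum_div, ← sum_add_distrib, ← sum_add_distrib]
  calc _ ≤ ∑ v : V, (1 : ℝ) := sum_le_sum fun v _ => ?_
    _ = Fintype.card V := by simp
  have h3 : #(levels S v) ≤ 3 := card_le_univ _
  generalize #(levels S v) = d at *
  interval_cases d <;> norm_num

/-- Three graphs that split, up to few edges, into a bipartite part and a part spanning few edges
cannot cover too many edges. -/
theorem card_sq_le_of_partitions (hAB : ∀ i, Disjoint (A i) (B i))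
    (hS : ∀ i, Disjoint (A i ∪ B i) (S i)) (hu : ∀ i, A i ∪ B i ∪ S i = univ) {n : ℕ} {δ : ℝ}
    (h₁ : ∀ i, adjPairs (G i) (A i) (A i) + adjPairs (G i) (B i) (B i) +
      2 * adjPairs (G i) (S i) (A i ∪ B i) ≤ δ)
    (h₂ : ∀ i, ∀ U ⊆ S i, adjPairs (G i) U U ≤ n * #U + δ)
    {H : SimpleGraph V} (hH : ∀ u v, H.Adj u v → ∃ i, (G i).Adj u v) :
    (Fintype.card V : ℝ) ^ 2 ≤ 4 * n * Fintype.card V + 36 * δ +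
      8 * (Fintype.card V ^ 2 - adjPairs H univ univ) := by
  have hpt : ∀ u v, ∏ i, (1 + label A B u i * label A B v i) ≤
      8 * (1 - adjInd H univ univ u v) + ∑ i, excess G A B S i u v := by
    intro u v
    by_cases h : H.Adj u v
    · obtain ⟨i, hi⟩ := hH u v h
      rw [adjInd_eq_one (mem_univ _) (mem_univ _) h, sub_self, mul_zero, zero_add]
      exact (prod_label_le_excess hAB hS hu hi).trans
        (single_le_sum (fun j _ => excess_nonneg j u v) (mem_univ i))
    · have h1 : adjInd H univ univ u v = 0 := if_neg (by simp [h])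
      have h2 := prod_label_le_eight (A := A) (B := B) u v
      have h3 : 0 ≤ ∑ i, excess G A B S i u v := sum_nonneg fun i _ => excess_nonneg i u v
      rw [h1]
      linarith
  have hsum : ∑ u, ∑ v, (8 * (1 - adjInd H univ univ u v) + ∑ i, excess G A B S i u v) =
      8 * (Fintype.card V ^ 2 - adjPairs H univ univ) +
        ∑ i, ∑ u, ∑ v, excess G A B S i u v := by
    simp only [sum_add_distrib, ← mul_sum, sum_sub_distrib, sum_adjInd]
    congr 1
    · simp [sq]
    · rw [sum_congr rfl fun u _ => sum_comm, sum_comm]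
  have hex : ∑ i, ∑ u, ∑ v, excess G A B S i u v ≤
      ∑ i, (12 * δ + 4 * n * ((#(lowPart S i 1) : ℝ) / 2 + #(lowPart S i 2) / 6 +
        #(lowPart S i 3) / 3)) := by
    refine sum_le_sum fun i _ => ?_
    rw [sum_excess]
    have h1 := h₁ i
    have h2 := fun k => h₂ i (lowPart S i k) (filter_subset _ _)
    have := h2 1
    have := h2 2
    have := h2 3
    linarith
  rw [sum_add_distrib, ← mul_sum, ← mul_sum] at hex
  have hlow := mul_le_mul_of_nonneg_left (sum_card_lowPart_le (S := S))
    (by positivity : 0 ≤ 4 * (n : ℝ))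
  have h0 := (card_sq_le_sum_prod fun (i : Fin 3) v => label A B v i).trans
    (sum_le_sum fun u _ => sum_le_sum fun v _ => hpt u v)
  rw [hsum] at h0
  simp only [sum_const, card_univ, Fintype.card_fin, nsmul_eq_mul] at hex
  push_cast at hex
  linarith

end Fintype

/-- The graph of the edges of `H` that receive color `i`. -/
def colorGraph {V : Type*} {H : SimpleGraph V} (c : H.edgeSet → Fin 3) (i : Fin 3) :
    SimpleGraph V where
  Adj u v := ∃ h : H.Adj u v, c ⟨s(u, v), h⟩ = i
  symm := ⟨fun u v ⟨h, hc⟩ => ⟨h.symm, by simpa only [Sym2.eq_swap] using hc⟩⟩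
  loopless := ⟨fun v ⟨h, _⟩ => h.ne rfl⟩

lemma colorGraph_le {V : Type*} {H : SimpleGraph V} (c : H.edgeSet → Fin 3) (i : Fin 3) :
    colorGraph c i ≤ H := fun _ _ h => h.1

lemma color_eq_of_mem_edges {V : Type*} {H : SimpleGraph V} (c : H.edgeSet → Fin 3) {i : Fin 3}
    {v : V} (w : (colorGraph c i).Walk v v) (e : Sym2 V)
    (h : e ∈ (w.mapLe (colorGraph_le c i)).edges) :
    c ⟨e, (w.mapLe (colorGraph_le c i)).edges_subset_edgeSet h⟩ = i := by
  have h' : e ∈ (colorGraph c i).edgeSet := by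
    rw [SimpleGraph.Walk.edges_mapLe_eq_edges] at h
    exact w.edges_subset_edgeSet h
  induction e with
  | h a b => exact h'.2

theorem stmt10 (η : ℝ) (hη0 : 0 < η) (hη : η < 10 ^ (-5 : ℤ)) (t : ℕ)
    (ht : Real.exp (η ^ (-50 : ℤ)) ≤ (t : ℝ)) {V : Type*} [Fintype V] (H : SimpleGraph V)
    (T : ℕ) (hT : Fintype.card V = T) (hTt : 4 * (1 + η) * (t : ℝ) ≤ (T : ℝ))
    (hE : (1 - η ^ 3) * (T.choose 2 : ℝ) ≤ (Nat.card H.edgeSet : ℝ)) :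
    ∀ c : H.edgeSet → Fin 3, ∃ (i : Fin 3) (v : V) (w : H.Walk v v),
      w.IsCycle ∧ Odd w.length ∧ (1 + η / 10) * (t : ℝ) ≤ (w.length : ℝ) ∧
      ∀ e (h : e ∈ w.edges), c ⟨e, w.edges_subset_edgeSet h⟩ = i := by
  classical
  intro c
  by_contra hcon
  have hη' : η ≤ 1 / 100000 := by norm_num at hη; linarith
  obtain ⟨x, hx⟩ : ∃ x : ℝ, x = 1 / η := ⟨_, rfl⟩
  have hxη : x * η = 1 := by rw [hx]; field_simp
  have hx1 : 100000 ≤ x := by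
    rw [hx, le_div_iff₀ hη0]; linarith
  have htx : 10 ^ 12 * x ^ 3 ≤ (t : ℝ) := by
    have h1 : η ^ (-50 : ℤ) = x ^ 50 := by
      rw [hx, zpow_neg, one_div, inv_pow]
      norm_cast
    rw [h1] at ht
    have h2 := Real.add_one_le_exp (x ^ 50)
    have h3 : (10 : ℝ) ^ 12 ≤ x ^ 47 := by
      calc (10 : ℝ) ^ 12 ≤ 100000 ^ 47 := by norm_num
        _ ≤ x ^ 47 := by gcongr
    have h4 : x ^ 50 = x ^ 47 * x ^ 3 := by ring
    have h5 := mul_le_mul_of_nonneg_right h3 (by positivity : 0 ≤ x ^ 3)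
    linarith
  obtain ⟨n, hndef⟩ : ∃ n : ℕ, n = ⌈(1 + η / 10) * (t : ℝ)⌉₊ := ⟨_, rfl⟩
  have hn1 : (1 + η / 10) * (t : ℝ) ≤ n := hndef ▸ Nat.le_ceil _
  have hn2 : (n : ℝ) ≤ (1 + η / 10) * t + 1 :=
    hndef ▸ (Nat.ceil_lt_add_one (by positivity)).le
  have ht0 : (0 : ℝ) < t := lt_of_lt_of_le (by positivity) htx
  have hbig : 1536 / (η / 200) ^ 3 ≤ (n : ℝ) := by
    have h1 : 1536 / (η / 200) ^ 3 = 1536 * 200 ^ 3 * x ^ 3 := by rw [hx]; field_simp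
    have h2 : (t : ℝ) ≤ n := by nlinarith
    rw [h1]
    have : 0 ≤ x ^ 3 := by positivity
    linarith
  have hcyc : ∀ i, ∀ (v : V) (w : (colorGraph c i).Walk v v), w.IsCycle → Odd w.length →
      w.length < n := by
    intro i v w hw ho
    by_contra! hlen
    refine hcon ⟨i, v, w.mapLe (colorGraph_le c i), hw.mapLe _, ?_, ?_,
      color_eq_of_mem_edges c w⟩
    · rwa [SimpleGraph.Walk.length_mapLe]
    · rw [SimpleGraph.Walk.length_mapLe]
      exact hn1.trans (by exact_mod_cast hlen)
  have hpart := fun i => exists_bipartite_sparse_partition (ε := η / 200) (by positivity)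
    (by linarith) hbig (hcyc i) univ
  choose A B S hAB hS hu h₁ h₂ using hpart
  have hcount := card_sq_le_of_partitions hAB hS hu h₁ h₂ (H := H)
    fun u v h => ⟨_, h, rfl⟩
  rw [adjPairs_univ_eq_twice_card_edgeSet, card_univ, hT] at hcount
  rw [Nat.cast_choose_two] at hE
  have hT0 : (0 : ℝ) < T := by nlinarith
  have hmain : (T : ℝ) ≤ 4 * n + 36 * (η / 200) * T + 8 * (η ^ 3 * T + 1) := by
    have h3 : 0 < η ^ 3 := by positivity
    refine le_of_mul_le_mul_right (a := (T : ℝ)) ?_ hT0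
    nlinarith
  have hη3 : 8 * η ^ 3 ≤ η / 100 := by
    have : η ^ 2 ≤ 1 / 800 := by nlinarith
    nlinarith
  have h4 : (T : ℝ) * (1 - 19 / 100 * η) ≤ 4 * (1 + η / 10) * t + 12 := by
    have := mul_le_mul_of_nonneg_right hη3 hT0.le
    nlinarith
  have h5 := mul_le_mul_of_nonneg_right hTt (by linarith : 0 ≤ 1 - 19 / 100 * η)
  have h6 : 100 ≤ η * t := by
    have := mul_le_mul_of_nonneg_left htx hη0.le
    have h7 : η * (10 ^ 12 * x ^ 3) = 10 ^ 12 * x ^ 2 := by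
      linear_combination 10 ^ 12 * x ^ 2 * hxη
    nlinarith
  nlinarith
end

section
/- For every real β with 0 < β < 1 there exists an integer n₀ such that for every integer n > n₀ the following holds. Let G be a bipartite graph with bipartition V(G) = V₁ ∪ V₂, |V₁| = |V₂| = n, and suppose that for some real ε with 0 < ε < β/100 the pair (V₁,V₂) is ε-regular in G with density d_G(V₁,V₂) ≥ β/4. Then for every integer ℓ with 1 ≤ ℓ ≤ n − 5εn/β and for every pair of vertices v′ ∈ V₁ and v″ ∈ V₂ with deg_G(v′) ≥ βn/5 and deg_G(v″) ≥ βn/5, the graph G contains a path with exactly 2ℓ+1 edges whose endpoints are v′ and v″. -/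
-- The number of edges of `G` with one endpoint in `U` and the other in `W`
-- (for disjoint `U`, `W`).
open Classical in
noncomputable def edgesBetween {V : Type*} (G : SimpleGraph V) (U W : Finset V) : ℕ :=
  ((U ×ˢ W).filter fun e => G.Adj e.1 e.2).card

/-- The density `d_G(U,W) = e_G(U,W) / (|U||W|)`. -/
noncomputable def pairDensity {V : Type*} (G : SimpleGraph V) (U W : Finset V) : ℝ :=
  (edgesBetween G U W : ℝ) / ((U.card : ℝ) * (W.card : ℝ))

/-- The pair `(U, W)` is `ε`-regular in `G`. -/
def IsRegularPair {V : Type*} (G : SimpleGraph V) (ε : ℝ) (U W : Finset V) : Prop :=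
  ∀ X ⊆ U, ∀ Y ⊆ W, ε * U.card ≤ X.card → ε * W.card ≤ Y.card →
    |pairDensity G X Y - pairDensity G U W| ≤ ε

namespace SimpleGraph

variable {V : Type*} {G : SimpleGraph V} {A B : Finset V}

/-- In a bipartite graph with parts `A` and `B`, the length of a path ending in `A` determines
the part of its first vertex and its number of vertices in each part. -/
lemma Walk.IsPath.bipartite_card [DecidableEq V] (hAB : Disjoint A B)
    (hbip : ∀ u v, G.Adj u v → (u ∈ A ∧ v ∈ B) ∨ (u ∈ B ∧ v ∈ A))
    {x v : V} {p : G.Walk x v} (hp : p.IsPath) (hv : v ∈ A) :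
    (∀ u ∈ p.support, u ∈ A ∨ u ∈ B) ∧
    ((x ∈ A ∧ p.length % 2 = 0) ∨ (x ∈ B ∧ p.length % 2 = 1)) ∧
    (A.filter (· ∈ p.support)).card = p.length / 2 + 1 ∧
    (B.filter (· ∈ p.support)).card = (p.length + 1) / 2 := by
  induction p with
  | nil =>
    have hvB := Finset.disjoint_left.1 hAB hv
    have hA : A.filter (· = _) = {_} := Finset.filter_eq' A _ |>.trans (if_pos hv)
    have hB : B.filter (· = _) = ∅ := Finset.filter_eq' B _ |>.trans (if_neg hvB)
    simp [hv, hA, hB]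
  | @cons x y v h p ih =>
    rw [Walk.cons_isPath_iff] at hp
    obtain ⟨hsub, hpar, hcA, hcB⟩ := ih hp.1 hv
    have split (S : Finset V) (hxS : x ∈ S) :
        (S.filter (· ∈ (Walk.cons h p).support)).card
          = (S.filter (· ∈ p.support)).card + 1 := by
      rw [← Finset.card_insert_of_notMem (a := x) (by simp [hp.2])]
      congr 1
      ext u
      simp only [Walk.support_cons, List.mem_cons, Finset.mem_filter, Finset.mem_insert]
      grind
    have stay (S : Finset V) (hxS : x ∉ S) :
        S.filter (· ∈ (Walk.cons h p).support) = S.filter (· ∈ p.support) := by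
      ext u
      simp only [Walk.support_cons, List.mem_cons, Finset.mem_filter]
      grind
    have hlen : (Walk.cons h p).length = p.length + 1 := Walk.length_cons h p
    refine ⟨?_, ?_⟩
    · intro u hu
      rw [Walk.support_cons, List.mem_cons] at hu
      rcases hu with rfl | hu
      · rcases hbip _ _ h with h1 | h1
        · exact Or.inl h1.1
        · exact Or.inr h1.1
      · exact hsub u hu
    rcases hbip x y h with ⟨hx, hy⟩ | ⟨hx, hy⟩
    · have hxB := Finset.disjoint_left.1 hAB hx
      have hyA := Finset.disjoint_right.1 hAB hy
      rw [split A hx, stay B hxB, hcA, hcB, hlen]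
      have : p.length % 2 = 1 := by tauto
      exact ⟨Or.inl ⟨hx, by omega⟩, by omega, by omega⟩
    · have hxA := Finset.disjoint_right.1 hAB hx
      have hyB := Finset.disjoint_left.1 hAB hy
      rw [split B hx, stay A hxA, hcA, hcB, hlen]
      have : p.length % 2 = 0 := by tauto
      exact ⟨Or.inr ⟨hx, by omega⟩, by omega, by omega⟩

/-- Depth-first search: a path `p` and a set `D` of discarded vertices with no neighbours outside
`D` and `p` can be developed until the path has `2 * k` vertices. -/
lemma exists_isPath_of_search_state [DecidableEq V] {M k : ℕ} (hAB : Disjoint A B)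
    (hbip : ∀ u v, G.Adj u v → (u ∈ A ∧ v ∈ B) ∨ (u ∈ B ∧ v ∈ A))
    (hole : ∀ X ⊆ A, ∀ Y ⊆ B, M ≤ X.card → M ≤ Y.card → ∃ x ∈ X, ∃ y ∈ Y, G.Adj x y)
    (hA : k + 2 * M ≤ A.card + 2) (hB : k + 2 * M ≤ B.card + 2) {v : V} (hv : v ∈ A)
    (hdeg : ∃ Y ⊆ B, M ≤ Y.card ∧ ∀ y ∈ Y, G.Adj v y)
    (N : ℕ) {x : V} (p : G.Walk x v) (D : Finset V) (hp : p.IsPath)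
    (hlen : p.length + 1 ≤ 2 * k) (hDp : ∀ u ∈ D, u ∉ p.support)
    (hDA : (A ∩ D).card < M) (hDB : (B ∩ D).card < M)
    (hD : ∀ d ∈ D, ∀ u, G.Adj d u → u ∈ D ∨ u ∈ p.support)
    (hN : 4 * M + 2 * k ≤ 2 * ((A ∩ D).card + (B ∩ D).card) + p.length + N) :
    ∃ y, ∃ q : G.Walk y v, q.IsPath ∧ q.length + 1 = 2 * k := by
  induction N generalizing x D with
  | zero => omega
  | succ N ih =>
    by_cases hdone : p.length + 1 = 2 * k
    · exact ⟨x, p, hp, hdone⟩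
    by_cases hext : ∃ u, G.Adj x u ∧ u ∉ D ∧ u ∉ p.support
    · obtain ⟨u, hxu, huD, hup⟩ := hext
      refine ih (Walk.cons hxu.symm p) D ?_ ?_ ?_ hDA hDB ?_ ?_
      · rw [Walk.cons_isPath_iff]
        exact ⟨hp, hup⟩
      · rw [Walk.length_cons]
        omega
      · intro d hd
        rw [Walk.support_cons, List.mem_cons]
        rintro (rfl | h)
        · exact huD hd
        · exact hDp d hd h
      · intro d hd w hdw
        rw [Walk.support_cons, List.mem_cons]
        rcases hD d hd w hdw with h | h <;> tauto
      · rw [Walk.length_cons]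
        omega
    push Not at hext
    obtain ⟨-, hpar, hcA, hcB⟩ := hp.bipartite_card hAB hbip hv
    have hxD : x ∉ D := fun h => hDp x h p.start_mem_support
    have hclosed : ∀ d ∈ insert x D, ∀ u, G.Adj d u → u ∈ D ∨ u ∈ p.support := by
      intro d hd u hdu
      rcases Finset.mem_insert.1 hd with rfl | hd
      · by_cases huD : u ∈ D
        · exact Or.inl huD
        · exact Or.inr (hext u hdu huD)
      · exact hD d hd u hdu
    have unvisited (S : Finset V) : S.card ≤ (S.filter fun u => u ∉ D ∧ u ∉ p.support).card
        + (S ∩ D).card + (S.filter (· ∈ p.support)).card := by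
      refine le_trans (Finset.card_le_card ?_) ((Finset.card_union_le _ _).trans
        (Nat.add_le_add_right (Finset.card_union_le _ _) _))
      intro u hu
      simp only [Finset.mem_union, Finset.mem_filter, Finset.mem_inter]
      tauto
    have hUA := unvisited A
    have hUB := unvisited B
    have hnew : (A ∩ insert x D).card < M ∧ (B ∩ insert x D).card < M ∧
        (A ∩ insert x D).card + (B ∩ insert x D).card
          = (A ∩ D).card + (B ∩ D).card + 1 := by
      rcases hpar with ⟨hx, hl⟩ | ⟨hx, hl⟩
      · have hxB := Finset.disjoint_left.1 hAB hx
        rw [Finset.inter_insert_of_notMem hxB, Finset.inter_insert_of_mem hx,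
          Finset.card_insert_of_notMem (by simp [hxD])]
        refine ⟨?_, hDB, by omega⟩
        by_contra hM
        obtain ⟨d, hd, u, hu, hdu⟩ := hole (A ∩ insert x D) Finset.inter_subset_left
          (B.filter fun u => u ∉ D ∧ u ∉ p.support) (Finset.filter_subset _ _)
          (by rw [Finset.inter_insert_of_mem hx,
                Finset.card_insert_of_notMem (by simp [hxD])]; omega) (by omega)
        have := hclosed d (Finset.mem_inter.1 hd).2 u hdu
        have := (Finset.mem_filter.1 hu).2
        tauto
      · have hxA := Finset.disjoint_right.1 hAB hx
        rw [Finset.inter_insert_of_notMem hxA, Finset.inter_insert_of_mem hx,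
          Finset.card_insert_of_notMem (by simp [hxD])]
        refine ⟨hDA, ?_, by omega⟩
        by_contra hM
        obtain ⟨u, hu, d, hd, hud⟩ := hole (A.filter fun u => u ∉ D ∧ u ∉ p.support)
          (Finset.filter_subset _ _) (B ∩ insert x D) Finset.inter_subset_left (by omega)
          (by rw [Finset.inter_insert_of_mem hx,
                Finset.card_insert_of_notMem (by simp [hxD])]; omega)
        have := hclosed d (Finset.mem_inter.1 hd).2 u hud.symm
        have := (Finset.mem_filter.1 hu).2
        tauto
    cases p with
    | nil =>
      obtain ⟨Y, hYB, hYM, hY⟩ := hdeg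
      have : Y ⊆ B ∩ D := by
        intro y hy
        refine Finset.mem_inter.2 ⟨hYB hy, ?_⟩
        rcases hclosed _ (Finset.mem_insert_self _ _) y (hY y hy) with h | h
        · exact h
        · rw [Walk.support_nil, List.mem_singleton] at h
          exact absurd h (hY y hy).ne'
      have := Finset.card_le_card this
      omega
    | cons h p =>
      rw [Walk.cons_isPath_iff] at hp
      rw [Walk.length_cons] at hN hlen
      refine ih p (insert x D) hp.1 (by omega) ?_ hnew.1 hnew.2.1 ?_ (by omega)
      · intro u hu
        rcases Finset.mem_insert.1 hu with rfl | hu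
        · exact hp.2
        · intro h'
          exact hDp u hu (by rw [Walk.support_cons]; exact List.mem_cons_of_mem _ h')
      · intro d hd u hdu
        have := hclosed d hd u hdu
        rw [Walk.support_cons, List.mem_cons] at this
        rw [Finset.mem_insert]
        tauto

/-- If a bipartite graph with large parts `A`, `B` has an edge between any two subsets of size `M`
of the parts, then every vertex of `A` of degree at least `M` is an end of a path with `k` vertices
in each part. -/
lemma exists_isPath_of_no_bipartite_hole {M k : ℕ} (hM : 0 < M) (hk : 0 < k)
    (hAB : Disjoint A B)
    (hbip : ∀ u v, G.Adj u v → (u ∈ A ∧ v ∈ B) ∨ (u ∈ B ∧ v ∈ A))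
    (hole : ∀ X ⊆ A, ∀ Y ⊆ B, M ≤ X.card → M ≤ Y.card → ∃ x ∈ X, ∃ y ∈ Y, G.Adj x y)
    (hA : k + 2 * M ≤ A.card + 2) (hB : k + 2 * M ≤ B.card + 2) {v : V} (hv : v ∈ A)
    (hdeg : ∃ Y ⊆ B, M ≤ Y.card ∧ ∀ y ∈ Y, G.Adj v y) :
    ∃ y ∈ B, ∃ q : G.Walk y v, q.IsPath ∧ q.length + 1 = 2 * k ∧
      ∀ u ∈ q.support, u ∈ A ∨ u ∈ B := by
  classical
  obtain ⟨y, q, hq, hl⟩ := exists_isPath_of_search_state hAB hbip hole hA hB hv hdeg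
    (4 * M + 2 * k) (Walk.nil : G.Walk v v) ∅ Walk.IsPath.nil (by simp; omega) (by simp)
    (by simpa) (by simpa) (by simp) (by simp)
  obtain ⟨hsub, hpar, -⟩ := hq.bipartite_card hAB hbip hv
  refine ⟨y, ?_, q, hq, hl, hsub⟩
  rcases hpar with h | h
  · omega
  · exact h.1

/-- In a bipartite graph with parts `V₁`, `V₂` of size `n` and with an edge between any two subsets
of size `M` of the parts, two vertices of degree at least `2 * M` in opposite parts are joined by
paths of all odd lengths from `3` to `2 * (n + 2 - 3 * M) + 1`. -/
lemma exists_isPath_between_of_no_bipartite_hole {V₁ V₂ : Finset V} {M n ℓ : ℕ} (hM : 0 < M)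
    (hℓ : 0 < ℓ) (hdisj : Disjoint V₁ V₂) (h₁ : V₁.card = n) (h₂ : V₂.card = n)
    (hole : ∀ X ⊆ V₁, ∀ Y ⊆ V₂, M ≤ X.card → M ≤ Y.card → ∃ x ∈ X, ∃ y ∈ Y, G.Adj x y)
    (hn : ℓ + 3 * M ≤ n + 2) {a b : V} (ha : a ∈ V₁) (hb : b ∈ V₂)
    (hdega : ∃ Y ⊆ V₂, 2 * M ≤ Y.card ∧ ∀ y ∈ Y, G.Adj a y)
    (hdegb : ∃ X ⊆ V₁, 2 * M ≤ X.card ∧ ∀ x ∈ X, G.Adj b x) :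
    ∃ w : G.Walk a b, w.IsPath ∧ w.length = 2 * ℓ + 1 := by
  classical
  obtain ⟨X, hX, hXM, hbX⟩ := hdegb
  obtain ⟨Y, hY, hYM, haY⟩ := hdega
  have hXa : M ≤ (X.erase a).card := by
    have := Finset.pred_card_le_card_erase (s := X) (a := a)
    omega
  obtain ⟨Z, hZX, hZM⟩ := Finset.exists_subset_card_eq hXa
  have hZ₁ : Z ⊆ V₁ := (hZX.trans (Finset.erase_subset _ _)).trans hX
  let A := V₁ \ Z
  let B := (V₂.erase b).filter fun y => ∃ z ∈ Z, G.Adj z y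
  let W := (V₂.erase b).filter fun y => ¬ ∃ z ∈ Z, G.Adj z y
  have hA₁ : A ⊆ V₁ := Finset.sdiff_subset
  have hB₂ : B ⊆ V₂ := (Finset.filter_subset _ _).trans (Finset.erase_subset _ _)
  have hbB : b ∉ B := by simp [B]
  have hAB : Disjoint A B := Finset.disjoint_of_subset_left hA₁
    (Finset.disjoint_of_subset_right hB₂ hdisj)
  have hW : W.card < M := by
    by_contra hW
    obtain ⟨z, hz, y, hy, hzy⟩ := hole Z hZ₁ W
      ((Finset.filter_subset _ _).trans (Finset.erase_subset _ _)) hZM.ge (by omega)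
    exact (Finset.mem_filter.1 hy).2 ⟨z, hz, hzy⟩
  have hBW : B.card + W.card = n - 1 := by
    rw [← h₂, ← Finset.card_erase_of_mem hb]
    exact Finset.card_filter_add_card_filter_not _
  have hAc : A.card = n - M := by
    rw [Finset.card_sdiff_of_subset hZ₁, h₁, hZM]
  have haA : a ∈ A := Finset.mem_sdiff.2
    ⟨ha, fun h => Finset.notMem_erase a X (hZX h)⟩
  let H : SimpleGraph V :=
    { Adj := fun u v => G.Adj u v ∧ ((u ∈ A ∧ v ∈ B) ∨ (u ∈ B ∧ v ∈ A))
      symm := ⟨fun u v h => ⟨h.1.symm, by tauto⟩⟩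
      loopless := ⟨fun u h => G.loopless.irrefl u h.1⟩ }
  have hYB : M ≤ (Y ∩ B).card := by
    have hcover : Y ⊆ insert b (W ∪ (Y ∩ B)) := by
      intro y hy
      have := hY hy
      simp only [W, B, Finset.mem_insert, Finset.mem_union, Finset.mem_inter,
        Finset.mem_filter, Finset.mem_erase]
      tauto
    have := Finset.card_le_card hcover
    have := Finset.card_insert_le b (W ∪ (Y ∩ B))
    have := Finset.card_union_le W (Y ∩ B)
    omega
  obtain ⟨y, hyB, q, hq, hl, hsub⟩ := exists_isPath_of_no_bipartite_hole (G := H) (k := ℓ)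
    hM hℓ hAB (fun u v h => h.2)
    (fun X' hX' Y' hY' hXc hYc => by
      obtain ⟨x, hx, y, hy, hxy⟩ := hole X' (hX'.trans hA₁) Y' (hY'.trans hB₂) hXc hYc
      exact ⟨x, hx, y, hy, hxy, Or.inl ⟨hX' hx, hY' hy⟩⟩)
    (by omega) (by omega) haA
    ⟨Y ∩ B, Finset.inter_subset_right, hYB, fun y hy =>
      ⟨haY y (Finset.mem_inter.1 hy).1, Or.inl ⟨haA, (Finset.mem_inter.1 hy).2⟩⟩⟩
  have hHG : H ≤ G := fun u v h => h.1
  obtain ⟨z, hz, hzy⟩ := (Finset.mem_filter.1 hyB).2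
  have hbz : G.Adj b z := hbX z (Finset.mem_of_mem_erase (hZX hz))
  have hzq : z ∉ q.support := fun h => by
    rcases hsub z h with h | h
    · exact (Finset.mem_sdiff.1 h).2 hz
    · exact Finset.disjoint_left.1 hdisj (hZ₁ hz) (hB₂ h)
  have hbq : b ∉ q.support := fun h => by
    rcases hsub b h with h | h
    · exact Finset.disjoint_left.1 hdisj (hA₁ h) hb
    · exact hbB h
  refine ⟨(Walk.cons hbz (Walk.cons hzy (q.mapLe hHG))).reverse, ?_, ?_⟩
  · rw [Walk.isPath_reverse_iff, Walk.cons_isPath_iff, Walk.cons_isPath_iff]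
    refine ⟨⟨hq.mapLe hHG, ?_⟩, ?_⟩
    · simpa using hzq
    · simpa using ⟨hbz.ne, hbq⟩
  · simp only [Walk.length_reverse, Walk.length_cons, Walk.length_map]
    omega

end SimpleGraph

/-- Sufficiently large subsets of a regular pair whose density exceeds the regularity parameter
are joined by an edge. -/
lemma IsRegularPair.exists_adj {V : Type*} {G : SimpleGraph V} {ε : ℝ} {U W X Y : Finset V}
    (h : IsRegularPair G ε U W) (hd : ε < pairDensity G U W) (hX : X ⊆ U) (hY : Y ⊆ W)
    (hXc : ε * U.card ≤ X.card) (hYc : ε * W.card ≤ Y.card) :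
    ∃ x ∈ X, ∃ y ∈ Y, G.Adj x y := by
  by_contra! hno
  have hzero : edgesBetween G X Y = 0 := by
    classical
    unfold edgesBetween
    rw [Finset.card_eq_zero, Finset.filter_eq_empty_iff]
    intro e he
    exact hno _ (Finset.mem_product.1 he).1 _ (Finset.mem_product.1 he).2
  have := (abs_le.1 (h X hX Y hY hXc hYc)).1
  rw [pairDensity, hzero, Nat.cast_zero, zero_div] at this
  linarith

theorem stmt11 (β : ℝ) (hβ0 : 0 < β) (hβ1 : β < 1) :
    ∃ n₀ : ℕ, ∀ n : ℕ, n₀ < n → ∀ {V : Type*} [Fintype V] (G : SimpleGraph V)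
      (V₁ V₂ : Finset V), Disjoint V₁ V₂ → (∀ v : V, v ∈ V₁ ∨ v ∈ V₂) →
      V₁.card = n → V₂.card = n →
      (∀ u v : V, G.Adj u v → (u ∈ V₁ ∧ v ∈ V₂) ∨ (u ∈ V₂ ∧ v ∈ V₁)) →
      ∀ ε : ℝ, 0 < ε → ε < β / 100 →
      IsRegularPair G ε V₁ V₂ → β / 4 ≤ pairDensity G V₁ V₂ →
      ∀ ℓ : ℕ, 1 ≤ ℓ → (ℓ : ℝ) ≤ (n : ℝ) - 5 * ε * n / β →
      ∀ v' ∈ V₁, ∀ v'' ∈ V₂,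
        β * n / 5 ≤ (Nat.card (G.neighborSet v') : ℝ) →
        β * n / 5 ≤ (Nat.card (G.neighborSet v'') : ℝ) →
        ∃ w : G.Walk v' v'', w.IsPath ∧ w.length = 2 * ℓ + 1 := by
  refine ⟨⌈15 / β⌉₊, ?_⟩
  intro n hn V _ G V₁ V₂ hdisj _ h₁ h₂ hbip ε hε hεβ hreg hd ℓ hℓ hℓn a ha b hb hda hdb
  classical
  have hβn : 15 < β * n := by
    have := (Nat.le_ceil (15 / β)).trans_lt (Nat.cast_lt.2 hn)
    rwa [div_lt_iff₀' hβ0] at this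
  have hn0 : (0 : ℝ) < n := by
    by_contra h
    nlinarith
  have hεn : 0 < ε * n := mul_pos hε hn0
  have hεβn : ε * n ≤ β / 100 * n := by gcongr
  have hceil := Nat.ceil_lt_add_one hεn.le
  have hceil' := Nat.le_ceil (ε * n)
  have hM : 0 < ⌈ε * n⌉₊ := Nat.ceil_pos.2 hεn
  have hneighbors (v : V) (S : Finset V) (hS : ∀ u, G.Adj v u → u ∈ S)
      (hv : β * n / 5 ≤ (Nat.card (G.neighborSet v) : ℝ)) :
      ∃ Y ⊆ S, 2 * ⌈ε * n⌉₊ ≤ Y.card ∧ ∀ y ∈ Y, G.Adj v y := by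
    refine ⟨G.neighborFinset v, fun u hu => hS u ((G.mem_neighborFinset v u).1 hu), ?_,
      fun y hy => (G.mem_neighborFinset v y).1 hy⟩
    rw [Nat.card_eq_fintype_card, SimpleGraph.card_neighborSet_eq_degree] at hv
    rw [SimpleGraph.card_neighborFinset_eq_degree]
    have : (2 * ⌈ε * n⌉₊ : ℝ) ≤ G.degree v := by linarith
    exact_mod_cast this
  refine SimpleGraph.exists_isPath_between_of_no_bipartite_hole hM hℓ hdisj h₁ h₂ ?_ ?_ ha hb
    (hneighbors a V₂ ?_ hda) (hneighbors b V₁ ?_ hdb)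
  · intro X hX Y hY hXc hYc
    refine hreg.exists_adj (by linarith) hX hY ?_ ?_
    · rw [h₁]
      exact hceil'.trans (Nat.cast_le.2 hXc)
    · rw [h₂]
      exact hceil'.trans (Nat.cast_le.2 hYc)
  · have h5 : 5 * ε * n ≤ 5 * ε * n / β := by
      rw [le_div_iff₀ hβ0]
      nlinarith
    have : (ℓ + 5 * ⌈ε * n⌉₊ : ℝ) < n + 5 := by linarith
    have : ℓ + 5 * ⌈ε * n⌉₊ < n + 5 := by exact_mod_cast this
    omega
  · intro u hu
    rcases hbip a u hu with h | h
    · exact h.2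
    · exact absurd h.1 (Finset.disjoint_left.1 hdisj ha)
  · intro u hu
    rcases hbip b u hu with h | h
    · exact absurd hb (Finset.disjoint_left.1 hdisj h.1)
    · exact h.2
end
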